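/- Let 𝔾' be obtained from 𝔾 by a stabilization of type X:SW, with distinguished point c and splitting GC•(𝔾₄') = I₄ ⊕ N₄. The one-to-one correspondence between I₄(𝔾₄') and S₄(𝔾₄) (induced by x' = x ∪ {c} ↦ x) induces an isomorphism e₄ : (I₄, ∂_{I₄}^{I₄}) → GC•(𝔾₄)[V₁]⟦1,1⟧ of bigraded chain complexes over 𝔽[V₁,…,V_n,v]. -/

import Mathlib

/-!
Combinatorial model of toroidal grid diagrams, their 4-fold covers, and the
double-point enhanced grid complex (over 𝔽 = ℤ/2ℤ), following Lipshitz and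
Ozsváth–Szabó–Sarkar conventions.

* The torus is modelled by `ZMod n × ZMod n`: the horizontal circle `α_j` and
  vertical circle `β_k` meet at the point `(k, j)`; the square `(k, j)` is the
  one with south-west corner at the point `(k, j)`;  the `O`- and `X`-markings
  of column `k` occupy squares `(k, Orow k)` and `(k, Xrow k)`.
* A grid state is a bijection (column ↦ row), i.e. a permutation of `ZMod n`.
* The 4-fold cover `𝔾₄` lives on `ZMod (2n) × ZMod (2n)`, with the covering
  map `pr` reducing coordinates mod `n`.  A grid state of `𝔾₄` is the preimage
  of a grid state of `𝔾`, so grid states of `𝔾₄` are canonically identified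
  with grid states of `𝔾`; similarly the free module `GC` underlying both
  `GC•(𝔾)` and `GC•(𝔾₄)` is the same, and the identification `J₄` is the
  identity map.
* Rectangles are recorded by their two vertical circles (west/east) and two
  horizontal circles (south/north); "rectangle from x₄ to y₄" is the boundary
  condition `∂(∂_α(r + Nr + Er + NEr)) = y₄ - x₄` (and the `∂_β` analogue),
  expressed via corner-point indicator functions.  Each `N,E`-equivalence class
  of rectangles in `𝔾₄` contains exactly one *normalized* representative
  (west circle and south circle in the first fundamental domain), so sums over
  equivalence classes are sums over normalized representatives.
-/

noncomputable section

open scoped Classical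

namespace GridHomology

/-- the ground field `𝔽 = ℤ/2ℤ` -/
abbrev F : Type := ZMod 2

/-- A toroidal grid diagram of grid number `n`. -/
structure GridDiagram (n : ℕ) where
  Orow : ZMod n → ZMod n
  Xrow : ZMod n → ZMod n
  hO : Function.Bijective Orow
  hX : Function.Bijective Xrow
  hOX : ∀ i, Orow i ≠ Xrow i

/-- A grid state: one point on each horizontal and each vertical circle. -/
abbrev GridState (n : ℕ) := Equiv.Perm (ZMod n)

instance twoMulNeZero (n : ℕ) [NeZero n] : NeZero (2 * n) :=
  ⟨fun h => NeZero.ne n (by omega)⟩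

/-- membership in the cyclic (going east/north) interval `[u, v)` -/
def inIco {m : ℕ} (u v k : ZMod m) : Prop := (k - u).val < (v - u).val

/-- membership in the open cyclic interval `(u, v)` -/
def inIoo {m : ℕ} (u v k : ZMod m) : Prop :=
  0 < (k - u).val ∧ (k - u).val < (v - u).val

instance {m : ℕ} (u v k : ZMod m) : Decidable (inIco u v k) :=
  inferInstanceAs (Decidable (_ < _))

instance {m : ℕ} (u v k : ZMod m) : Decidable (inIoo u v k) :=
  inferInstanceAs (Decidable (_ ∧ _))

/-- Rectangle data on the `m × m` torus: west and east vertical circles,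
south and north horizontal circles. -/
structure Rect (m : ℕ) where
  cW : ZMod m
  cE : ZMod m
  rS : ZMod m
  rN : ZMod m
deriving DecidableEq

instance (m : ℕ) [NeZero m] : Fintype (Rect m) :=
  Fintype.ofEquiv (ZMod m × ZMod m × ZMod m × ZMod m)
    { toFun := fun p => ⟨p.1, p.2.1, p.2.2.1, p.2.2.2⟩
      invFun := fun r => ⟨r.cW, r.cE, r.rS, r.rN⟩
      left_inv := fun _ => rfl
      right_inv := fun _ => rfl }

/-- local multiplicity of a rectangle at a square of the torus -/
def Rect.mult {m : ℕ} (r : Rect m) (sq : ZMod m × ZMod m) : ℕ :=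
  if inIco r.cW r.cE sq.1 ∧ inIco r.rS r.rN sq.2 then 1 else 0

/-- `r` is an (embedded, not necessarily empty) rectangle from `x` to `y` in `𝔾`:
its south-west and north-east corners lie in `x`, its south-east and north-west
corners lie in `y`, and `x`, `y` agree away from the two vertical circles of `r`. -/
def IsRectFrom {m : ℕ} (x y : GridState m) (r : Rect m) : Prop :=
  r.cW ≠ r.cE ∧ r.rS ≠ r.rN ∧
  x r.cW = r.rS ∧ x r.cE = r.rN ∧ y r.cW = r.rN ∧ y r.cE = r.rS ∧
  ∀ k, k ≠ r.cW → k ≠ r.cE → x k = y k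

/-- point-measure of a rectangle in `𝔾` at a grid state `w`: the sum over the
points of `w` of the average of the four adjacent local multiplicities -/
def Rect.pm {m : ℕ} [NeZero m] (w : GridState m) (r : Rect m) : ℚ :=
  (∑ k : ZMod m, ((r.mult (k - 1, w k - 1) + r.mult (k, w k - 1) +
      r.mult (k - 1, w k) + r.mult (k, w k) : ℕ) : ℚ)) / 4

/-- `m(r) = #(Int r ∩ x)` -/
def Rect.intCount {m : ℕ} [NeZero m] (x : GridState m) (r : Rect m) : ℕ :=
  (Finset.univ.filter fun k => inIoo r.cW r.cE k ∧ inIoo r.rS r.rN (x k)).card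

/-- `O_i(r)` in `𝔾` -/
def Ocount {m : ℕ} (G : GridDiagram m) (r : Rect m) (i : ZMod m) : ℕ :=
  r.mult (i, G.Orow i)

/-- `X_i(r)` in `𝔾` -/
def Xcount {m : ℕ} (G : GridDiagram m) (r : Rect m) (i : ZMod m) : ℕ :=
  r.mult (i, G.Xrow i)

/-- `r ∩ 𝕏 = ∅` -/
def XDisjoint {m : ℕ} (G : GridDiagram m) (r : Rect m) : Prop :=
  ∀ i, Xcount G r i = 0

/-! ### The 4-fold cover -/

/-- the covering projection `π₄ : 𝔾₄ → 𝔾` on coordinates -/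
def pr {n : ℕ} (a : ZMod (2 * n)) : ZMod n :=
  ZMod.castHom (dvd_mul_left n 2) (ZMod n) a

/-- indicator function (as a formal sum of points) of the lifted grid state `x₄` -/
def stInd {n : ℕ} (x : GridState n) (p : ZMod (2 * n) × ZMod (2 * n)) : ℤ :=
  if x (pr p.1) = pr p.2 then 1 else 0

/-- `∂(∂_α r)` as a formal sum of points: `SE + NW − SW − NE` -/
def cornerA {m : ℕ} (r : Rect m) (p : ZMod m × ZMod m) : ℤ :=
  (if p = (r.cE, r.rS) then 1 else 0) + (if p = (r.cW, r.rN) then 1 else 0)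
    - (if p = (r.cW, r.rS) then 1 else 0) - (if p = (r.cE, r.rN) then 1 else 0)

/-- `∂(∂_β r)` as a formal sum of points: `NE + SW − SE − NW` -/
def cornerB {m : ℕ} (r : Rect m) (p : ZMod m × ZMod m) : ℤ :=
  (if p = (r.cE, r.rN) then 1 else 0) + (if p = (r.cW, r.rS) then 1 else 0)
    - (if p = (r.cE, r.rS) then 1 else 0) - (if p = (r.cW, r.rN) then 1 else 0)

/-- northward translation `N` by `n` rows -/
def trN {n : ℕ} (r : Rect (2 * n)) : Rect (2 * n) :=
  ⟨r.cW, r.cE, r.rS + (n : ZMod (2 * n)), r.rN + (n : ZMod (2 * n))⟩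

/-- eastward translation `E` by `n` columns -/
def trE {n : ℕ} (r : Rect (2 * n)) : Rect (2 * n) :=
  ⟨r.cW + (n : ZMod (2 * n)), r.cE + (n : ZMod (2 * n)), r.rS, r.rN⟩

/-- `r` is a rectangle from `x₄` to `y₄` in the 4-fold diagram `𝔾₄`:
`∂(∂_α (r + Nr + Er + NEr)) = y₄ − x₄` and `∂(∂_β (r + Nr + Er + NEr)) = x₄ − y₄`. -/
def IsRect4From {n : ℕ} (x y : GridState n) (r : Rect (2 * n)) : Prop :=
  r.cW ≠ r.cE ∧ r.rS ≠ r.rN ∧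
  (∀ p, cornerA r p + cornerA (trN r) p + cornerA (trE r) p + cornerA (trN (trE r)) p
      = stInd y p - stInd x p) ∧
  (∀ p, cornerB r p + cornerB (trN r) p + cornerB (trE r) p + cornerB (trN (trE r)) p
      = stInd x p - stInd y p)

/-- the canonical (normalized) representative of each `{r, Nr, Er, NEr}`
equivalence class: west and south coordinates lie in the first fundamental domain -/
def normal4 {n : ℕ} (r : Rect (2 * n)) : Prop := r.cW.val < n ∧ r.rS.val < n

instance {n : ℕ} (r : Rect (2 * n)) : Decidable (normal4 r) :=
  inferInstanceAs (Decidable (_ ∧ _))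

/-- `O_i[r₄]`: total multiplicity of `r₄` at the four lifts of `O_i` -/
def O4count {n : ℕ} [NeZero n] (G : GridDiagram n) (r : Rect (2 * n)) (i : ZMod n) : ℕ :=
  ∑ p : ZMod (2 * n) × ZMod (2 * n),
    if pr p.1 = i ∧ pr p.2 = G.Orow i then r.mult p else 0

/-- `X_i[r₄]` -/
def X4count {n : ℕ} [NeZero n] (G : GridDiagram n) (r : Rect (2 * n)) (i : ZMod n) : ℕ :=
  ∑ p : ZMod (2 * n) × ZMod (2 * n),
    if pr p.1 = i ∧ pr p.2 = G.Xrow i then r.mult p else 0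

/-- `r₄ ∩ π₄⁻¹(𝕏) = ∅` -/
def XDisjoint4 {n : ℕ} [NeZero n] (G : GridDiagram n) (r : Rect (2 * n)) : Prop :=
  ∀ i, X4count G r i = 0

/-- point-measure of a domain (an integer-valued multiplicity function on the
squares of `𝔾₄`) at the lifted grid state `w₄` -/
def pm4 {n : ℕ} [NeZero n] (w : GridState n) (ψ : ZMod (2 * n) × ZMod (2 * n) → ℤ) : ℚ :=
  (∑ p : ZMod (2 * n) × ZMod (2 * n),
    if w (pr p.1) = pr p.2 then
      ((ψ (p.1 - 1, p.2 - 1) + ψ (p.1, p.2 - 1) + ψ (p.1 - 1, p.2) + ψ p : ℤ) : ℚ)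
    else 0) / 4

/-- a rectangle of `𝔾₄` viewed as a domain -/
def Rect.dom4 {n : ℕ} (r : Rect (2 * n)) : ZMod (2 * n) × ZMod (2 * n) → ℤ :=
  fun p => (r.mult p : ℤ)

/-- point-measure `p_{w₄}[r₄]` of a rectangle of `𝔾₄` -/
def rpm4 {n : ℕ} [NeZero n] (w : GridState n) (r : Rect (2 * n)) : ℚ :=
  pm4 w r.dom4

/-- `m[r₄] = (p_{x₄}[r₄] + p_{y₄}[r₄] − 1)/2`, as a rational number -/
def mQ4 {n : ℕ} [NeZero n] (x y : GridState n) (r : Rect (2 * n)) : ℚ :=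
  (rpm4 x r + rpm4 y r - 1) / 2

/-- `m[r₄]` as a natural number (the exponent of `v`) -/
def m4 {n : ℕ} [NeZero n] (x y : GridState n) (r : Rect (2 * n)) : ℕ :=
  (⌊mQ4 x y r⌋).toNat

/-! ### Maslov and Alexander gradings (via the planar counting function `J`) -/

/-- the points of a planar fundamental domain associated to `f`, in doubled
coordinates (grid states at even positions, markings at odd positions) -/
def ptsOf {m : ℕ} [NeZero m] (f : ZMod m → ZMod m) (off : ℕ) : Finset (ℕ × ℕ) :=
  Finset.univ.image fun k => (2 * k.val + off, 2 * (f k).val + off)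

/-- `I(P,Q)`: pairs `(p,q)` with `q` strictly above and strictly to the right of `p` -/
def Icnt (P Q : Finset (ℕ × ℕ)) : ℕ :=
  ∑ p ∈ P, (Q.filter fun q => p.1 < q.1 ∧ p.2 < q.2).card

/-- `J(P,Q) = (I(P,Q) + I(Q,P))/2` -/
def Jq (P Q : Finset (ℕ × ℕ)) : ℚ := ((Icnt P Q : ℚ) + (Icnt Q P : ℚ)) / 2

/-- the Maslov-type grading `J(x,x) − 2 J(x,P) + J(P,P) + 1` for markings `P` -/
def MaslovOf {m : ℕ} [NeZero m] (f : ZMod m → ZMod m) (x : GridState m) : ℚ :=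
  Jq (ptsOf (⇑x) 0) (ptsOf (⇑x) 0) - 2 * Jq (ptsOf (⇑x) 0) (ptsOf f 1)
    + Jq (ptsOf f 1) (ptsOf f 1) + 1

/-- the Maslov grading `M(x) = M_𝕆(x)` -/
def MaslovO {m : ℕ} [NeZero m] (G : GridDiagram m) (x : GridState m) : ℚ :=
  MaslovOf G.Orow x

/-- `M_𝕏(x)` -/
def MaslovX {m : ℕ} [NeZero m] (G : GridDiagram m) (x : GridState m) : ℚ :=
  MaslovOf G.Xrow x

/-- the Alexander grading `A(x) = (M_𝕆(x) − M_𝕏(x) − (n−1))/2` -/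
def Alex {m : ℕ} [NeZero m] (G : GridDiagram m) (x : GridState m) : ℚ :=
  (MaslovO G x - MaslovX G x - ((m : ℚ) - 1)) / 2

/-! ### The double-point enhanced grid complex -/

/-- the ring `𝔽[V₁, …, V_n, v]`: `V_i = X (some i)`, `v = X none` -/
abbrev Rng (n : ℕ) : Type := MvPolynomial (Option (ZMod n)) F

/-- the free `𝔽[V₁,…,V_n,v]`-module on the set of grid states; it underlies both
`GC•(𝔾)` and `GC•(𝔾₄)` (their grid states being canonically identified) -/
abbrev GC (n : ℕ) := GridState n →₀ Rng n

/-- the variable `V_i` -/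
def Vv {n : ℕ} (i : ZMod n) : Rng n := MvPolynomial.X (some i)

/-- the double-point variable `v` -/
def vV {n : ℕ} : Rng n := MvPolynomial.X none

/-- the `𝔽[V₁,…,V_n,v]`-linear map determined by values on grid states -/
def basisMap {n : ℕ} (f : GridState n → GC n) : GC n →ₗ[Rng n] GC n :=
  Finsupp.lsum (Rng n) fun x => LinearMap.toSpanSingleton (Rng n) (GC n) (f x)

/-- the weight `V₁^{O₁[r₄]} ⋯ V_n^{O_n[r₄]} v^{m[r₄]}` of a rectangle of `𝔾₄` -/
def wt4 {n : ℕ} [NeZero n] (G : GridDiagram n) (x y : GridState n) (r : Rect (2 * n)) :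
    Rng n :=
  (∏ i : ZMod n, Vv i ^ O4count G r i) * vV ^ m4 x y r

/-- the differential `∂₄•` of `GC•(𝔾₄)`: counts `N,E`-equivalence classes of
rectangles (via their normalized representatives) disjoint from `π₄⁻¹(𝕏)` -/
def diff4 {n : ℕ} [NeZero n] (G : GridDiagram n) : GC n →ₗ[Rng n] GC n :=
  basisMap fun x => ∑ y : GridState n,
    ∑ r ∈ Finset.univ.filter
        (fun r : Rect (2 * n) => IsRect4From x y r ∧ normal4 r ∧ XDisjoint4 G r),
      Finsupp.single y (wt4 G x y r)

/-- the weight of a rectangle of `𝔾` -/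
def wtB {n : ℕ} [NeZero n] (G : GridDiagram n) (x : GridState n) (r : Rect n) : Rng n :=
  (∏ i : ZMod n, Vv i ^ Ocount G r i) * vV ^ Rect.intCount x r

/-- the differential `∂•` of the double-point enhanced grid complex `GC•(𝔾)` -/
def diffB {n : ℕ} [NeZero n] (G : GridDiagram n) : GC n →ₗ[Rng n] GC n :=
  basisMap fun x => ∑ y : GridState n,
    ∑ r ∈ Finset.univ.filter
        (fun r : Rect n => IsRectFrom x y r ∧ XDisjoint G r),
      Finsupp.single y (wtB G x r)

/-- `z` is homogeneous of bidegree `(d, s)` for the (Maslov, Alexander) bigrading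
extended by `M(V₁^{k₁}⋯V_n^{k_n} v^m ⋅ x) = M(x) − 2Σkᵢ + 2m`,
`A(V₁^{k₁}⋯V_n^{k_n} v^m ⋅ x) = A(x) − Σkᵢ`. -/
def IsHomog {n : ℕ} [NeZero n] (G : GridDiagram n) (z : GC n) (d s : ℚ) : Prop :=
  ∀ (y : GridState n) (k : Option (ZMod n) →₀ ℕ), MvPolynomial.coeff k (z y) ≠ 0 →
    (MaslovO G y - 2 * ∑ i : ZMod n, (k (some i) : ℚ) + 2 * (k none : ℚ) = d) ∧
    (Alex G y - ∑ i : ZMod n, (k (some i) : ℚ) = s)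

/-- a linear map is homogeneous of degree `(a, b)` -/
def MapHomog {n : ℕ} [NeZero n] (G G' : GridDiagram n) (φ : GC n →ₗ[Rng n] GC n)
    (a b : ℚ) : Prop :=
  ∀ z d s, IsHomog G z d s → IsHomog G' (φ z) (d + a) (s + b)

/-- `𝔾` represents a knot: following the link (column `i` joins its `O` to the `X`
in the same row, etc.) visits every column -/
def IsKnot {n : ℕ} (G : GridDiagram n) : Prop :=
  ∀ i j : ZMod n, ∃ k : ℕ,
    (((Equiv.ofBijective G.Orow G.hO).trans (Equiv.ofBijective G.Xrow G.hX).symm) ^ k) i = j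

/-- the homotopy operator `𝓗_{X_j}•` counting equivalence classes of rectangles in
`𝔾₄` crossing the lifts of `X_j` exactly once and no other `X`-marking -/
def HXmap {n : ℕ} [NeZero n] (G : GridDiagram n) (j : ZMod n) : GC n →ₗ[Rng n] GC n :=
  basisMap fun x => ∑ y : GridState n,
    ∑ r ∈ Finset.univ.filter (fun r : Rect (2 * n) =>
        IsRect4From x y r ∧ normal4 r ∧ X4count G r j = 1 ∧
        ∀ k, k ≠ j → X4count G r k = 0),
      Finsupp.single y (wt4 G x y r)

/-! ### Commutation moves, pentagons and hexagons

`𝔾` and `𝔾'` differ by commuting the (adjacent) columns `c−1` and `c`; they are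
drawn on a common torus, sharing all markings and all circles except that the
vertical circle `β_c` of `𝔾` is replaced in `𝔾'` by a curve `γ_c` which passes
to the west of the marking line within the rows of the cyclic interval
`J = [h₁, h₂)` (which contains the markings of column `c−1`) and to the east of
it in the complementary rows (which contain the markings of column `c`);
`γ_c` crosses `β_c` at two points `a` (just south of the row-circle `h₂`) and
`b` (just south of `h₁`).  Grid states of `𝔾'` are again recorded as
permutations (the `γ`-point in row `j` replacing the `β_c`-point). -/

structure CommData (n : ℕ) where
  G : GridDiagram n
  G' : GridDiagram n
  c : ZMod n
  h₁ : ZMod n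
  h₂ : ZMod n
  hne : h₁ ≠ h₂
  hOA : inIco h₁ h₂ (G.Orow (c - 1))
  hXA : inIco h₁ h₂ (G.Xrow (c - 1))
  hOB : ¬ inIco h₁ h₂ (G.Orow c)
  hXB : ¬ inIco h₁ h₂ (G.Xrow c)
  hO'A : G'.Orow (c - 1) = G.Orow c
  hO'B : G'.Orow c = G.Orow (c - 1)
  hX'A : G'.Xrow (c - 1) = G.Xrow c
  hX'B : G'.Xrow c = G.Xrow (c - 1)
  hO' : ∀ k, k ≠ c - 1 → k ≠ c → G'.Orow k = G.Orow k
  hX' : ∀ k, k ≠ c - 1 → k ≠ c → G'.Xrow k = G.Xrow k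

/-- Pentagon data in the 4-fold torus `T₄`: the underlying rectangle
`I₄(p)` of `𝔾₄`, the side of the curved edge (`left = true` means the curved
vertical edge is the east edge of the rectangle), and the lifted height `hh`
of the crossing point (`a` or `b`) serving as the fifth corner. -/
structure Pent (n : ℕ) where
  rect : Rect (2 * n)
  left : Bool
  hh : ZMod (2 * n)
deriving DecidableEq

instance (n : ℕ) [NeZero n] : Fintype (Pent n) :=
  Fintype.ofEquiv (Rect (2 * n) × Bool × ZMod (2 * n))
    { toFun := fun p => ⟨p.1, p.2.1, p.2.2⟩
      invFun := fun p => ⟨p.rect, p.left, p.hh⟩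
      left_inv := fun _ => rfl
      right_inv := fun _ => rfl }

/-- the distinguished vertical edge lies on a lift of the curved circle -/
def onCedge {n : ℕ} (C : CommData n) (p : Pent n) : Prop :=
  if p.left then pr p.rect.cE = C.c else pr p.rect.cW = C.c

/-- the crossing point (at height just below the row circle `h`) lies strictly
inside the vertical extent of the rectangle -/
def heightOK {n : ℕ} (r : Rect (2 * n)) (h : ZMod (2 * n)) : Prop :=
  0 < (h - r.rS).val ∧ (h - r.rS).val ≤ (r.rN - r.rS).val

/-- a pentagon from `x₄ ∈ S₄(𝔾₄)` to `y₄' ∈ S₄(𝔾₄')` (with fifth corner at a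
lift of the distinguished point `a`) -/
def IsPentA {n : ℕ} (C : CommData n) (x y' : GridState n) (p : Pent n) : Prop :=
  IsRect4From x y' p.rect ∧ pr p.hh = C.h₂ ∧ onCedge C p ∧ heightOK p.rect p.hh

/-- a pentagon from `y₄' ∈ S₄(𝔾₄')` to `x₄ ∈ S₄(𝔾₄)` (fifth corner at a lift of `b`) -/
def IsPentB {n : ℕ} (C : CommData n) (y' x : GridState n) (p : Pent n) : Prop :=
  IsRect4From y' x p.rect ∧ pr p.hh = C.h₁ ∧ onCedge C p ∧ heightOK p.rect p.hh

/-- the rows along which the boundary of the pentagon runs along `γ` rather than `β_c` -/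
def detourA {n : ℕ} [NeZero n] (p : Pent n) : Finset (ZMod (2 * n)) :=
  if p.left then Finset.univ.filter (fun j => inIco p.rect.rS p.hh j)
  else Finset.univ.filter (fun j => inIco p.hh p.rect.rN j)

def detourB {n : ℕ} [NeZero n] (p : Pent n) : Finset (ZMod (2 * n)) :=
  if p.left then Finset.univ.filter (fun j => inIco p.hh p.rect.rN j)
  else Finset.univ.filter (fun j => inIco p.rect.rS p.hh j)

/-- marking-count correction along a curved edge: in a detour row `j`, if `γ` is
west (`π₄ j ∈ J`) the bigon sliver carries the column-`(c−1)` marking, otherwise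
it carries the column-`c` marking; the sliver is gained or lost according to
whether the region lies east (`east = true`) or west of the curved circle. -/
def adj {n : ℕ} [NeZero n] (C : CommData n) (f : ZMod n → ZMod n) (east : Bool)
    (D : Finset (ZMod (2 * n))) (i : ZMod n) : ℤ :=
  ∑ j ∈ D,
    if inIco C.h₁ C.h₂ (pr j) then
      (if i = C.c - 1 ∧ f (C.c - 1) = pr j then (if east then 1 else -1) else 0)
    else
      (if i = C.c ∧ f C.c = pr j then (if east then -1 else 1) else 0)

/-- `O_i[p₄]` for a pentagon counted by `P•` -/
def pentOA {n : ℕ} [NeZero n] (C : CommData n) (p : Pent n) (i : ZMod n) : ℤ :=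
  (O4count C.G p.rect i : ℤ) + adj C C.G.Orow (!p.left) (detourA p) i

def pentXA {n : ℕ} [NeZero n] (C : CommData n) (p : Pent n) (i : ZMod n) : ℤ :=
  (X4count C.G p.rect i : ℤ) + adj C C.G.Xrow (!p.left) (detourA p) i

def pentXDisjA {n : ℕ} [NeZero n] (C : CommData n) (p : Pent n) : Prop :=
  ∀ i, pentXA C p i = 0

def pentOB {n : ℕ} [NeZero n] (C : CommData n) (p : Pent n) (i : ZMod n) : ℤ :=
  (O4count C.G p.rect i : ℤ) + adj C C.G.Orow (!p.left) (detourB p) i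

def pentXB {n : ℕ} [NeZero n] (C : CommData n) (p : Pent n) (i : ZMod n) : ℤ :=
  (X4count C.G p.rect i : ℤ) + adj C C.G.Xrow (!p.left) (detourB p) i

def pentXDisjB {n : ℕ} [NeZero n] (C : CommData n) (p : Pent n) : Prop :=
  ∀ i, pentXB C p i = 0

/-- the weight `V₁^{O₁[p₄]}⋯V_n^{O_n[p₄]} v^{m[p₄]}`, with `m[p₄] = m[I₄(p₄)]` -/
def pentWtA {n : ℕ} [NeZero n] (C : CommData n) (x y' : GridState n) (p : Pent n) : Rng n :=
  (∏ i : ZMod n, Vv i ^ (pentOA C p i).toNat) * vV ^ m4 x y' p.rect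

def pentWtB {n : ℕ} [NeZero n] (C : CommData n) (y' x : GridState n) (p : Pent n) : Rng n :=
  (∏ i : ZMod n, Vv i ^ (pentOB C p i).toNat) * vV ^ m4 y' x p.rect

/-- the pentagon-counting map `P• : GC•(𝔾₄) → GC•(𝔾₄')` -/
def Pmap {n : ℕ} [NeZero n] (C : CommData n) : GC n →ₗ[Rng n] GC n :=
  basisMap fun x => ∑ y' : GridState n,
    ∑ p ∈ Finset.univ.filter (fun p : Pent n =>
        IsPentA C x y' p ∧ normal4 p.rect ∧ pentXDisjA C p),
      Finsupp.single y' (pentWtA C x y' p)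

/-- the pentagon-counting map `(P•)' : GC•(𝔾₄') → GC•(𝔾₄)` -/
def P'map {n : ℕ} [NeZero n] (C : CommData n) : GC n →ₗ[Rng n] GC n :=
  basisMap fun y' => ∑ x : GridState n,
    ∑ p ∈ Finset.univ.filter (fun p : Pent n =>
        IsPentB C y' x p ∧ normal4 p.rect ∧ pentXDisjB C p),
      Finsupp.single x (pentWtB C y' x p)

/-- Hexagon data: the underlying rectangle `I₄(h₄)` of `𝔾₄`, the side of its
curved edge, and the lifted heights of its two crossing-point corners
(`ha` a lift of `a`, `hb` a lift of `b`). -/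
structure Hex (n : ℕ) where
  rect : Rect (2 * n)
  left : Bool
  ha : ZMod (2 * n)
  hb : ZMod (2 * n)
deriving DecidableEq

instance (n : ℕ) [NeZero n] : Fintype (Hex n) :=
  Fintype.ofEquiv (Rect (2 * n) × Bool × ZMod (2 * n) × ZMod (2 * n))
    { toFun := fun p => ⟨p.1, p.2.1, p.2.2.1, p.2.2.2⟩
      invFun := fun p => ⟨p.rect, p.left, p.ha, p.hb⟩
      left_inv := fun _ => rfl
      right_inv := fun _ => rfl }

def onCedgeH {n : ℕ} (C : CommData n) (h : Hex n) : Prop :=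
  if h.left then pr h.rect.cE = C.c else pr h.rect.cW = C.c

/-- a hexagon from `x₄` to `y₄` (both states of `𝔾₄`) -/
def IsHex {n : ℕ} (C : CommData n) (x y : GridState n) (h : Hex n) : Prop :=
  IsRect4From x y h.rect ∧ pr h.ha = C.h₂ ∧ pr h.hb = C.h₁ ∧ onCedgeH C h ∧
  heightOK h.rect h.ha ∧ heightOK h.rect h.hb

/-- the rows between the two crossing-point corners of a hexagon -/
def detourH {n : ℕ} [NeZero n] (h : Hex n) : Finset (ZMod (2 * n)) :=
  if (h.ha - h.rect.rS).val < (h.hb - h.rect.rS).val then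
    Finset.univ.filter (fun j => inIco h.ha h.hb j)
  else Finset.univ.filter (fun j => inIco h.hb h.ha j)

def hexO {n : ℕ} [NeZero n] (C : CommData n) (h : Hex n) (i : ZMod n) : ℤ :=
  (O4count C.G h.rect i : ℤ) + adj C C.G.Orow (!h.left) (detourH h) i

def hexX {n : ℕ} [NeZero n] (C : CommData n) (h : Hex n) (i : ZMod n) : ℤ :=
  (X4count C.G h.rect i : ℤ) + adj C C.G.Xrow (!h.left) (detourH h) i

def hexXDisj {n : ℕ} [NeZero n] (C : CommData n) (h : Hex n) : Prop :=
  ∀ i, hexX C h i = 0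

def hexWt {n : ℕ} [NeZero n] (C : CommData n) (x y : GridState n) (h : Hex n) : Rng n :=
  (∏ i : ZMod n, Vv i ^ (hexO C h i).toNat) * vV ^ m4 x y h.rect

/-- the hexagon-counting map `H• : GC•(𝔾₄) → GC•(𝔾₄)` -/
def Hmap {n : ℕ} [NeZero n] (C : CommData n) : GC n →ₗ[Rng n] GC n :=
  basisMap fun x => ∑ y : GridState n,
    ∑ h ∈ Finset.univ.filter (fun h : Hex n =>
        IsHex C x y h ∧ normal4 h.rect ∧ hexXDisj C h),
      Finsupp.single y (hexWt C x y h)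

/-! ### Double-point enhanced grid homology -/

def cycles {n : ℕ} [NeZero n] (G : GridDiagram n) : Submodule (Rng n) (GC n) :=
  LinearMap.ker (diffB G)

def bdrIn {n : ℕ} [NeZero n] (G : GridDiagram n) : Submodule (Rng n) ↥(cycles G) :=
  Submodule.comap (cycles G).subtype (LinearMap.range (diffB G))

instance GHquotInst {n : ℕ} [NeZero n] (G : GridDiagram n) :
    HasQuotient ↥(cycles G) (Submodule (Rng n) ↥(cycles G)) :=
  Submodule.hasQuotient (R := Rng n) (M := ↥(cycles G))

/-- the double-point enhanced grid homology `GH•(𝔾)` -/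
abbrev GH {n : ℕ} [NeZero n] (G : GridDiagram n) := ↥(cycles G) ⧸ bdrIn G

/-- a homology class is homogeneous of degree `(d,s)` if it has a homogeneous
cycle representative -/
def GHhomog {n : ℕ} [NeZero n] (G : GridDiagram n) (h : GH G) (d s : ℚ) : Prop :=
  ∃ w : ↥(cycles G), (Submodule.Quotient.mk (R := Rng n) (M := ↥(cycles G)) w : GH G) = h ∧ IsHomog G (w : GC n) d s

/-! ### Commutation and stabilization moves as relations on grid diagrams -/

/-- `𝔾` and `𝔾'` differ by a column commutation move -/
def IsColComm {n : ℕ} (G G' : GridDiagram n) : Prop :=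
  ∃ C : CommData n, C.G = G ∧ C.G' = G'

/-- the transposed grid diagram (exchanging the roles of rows and columns) -/
def GridDiagram.transpose {n : ℕ} (G : GridDiagram n) : GridDiagram n where
  Orow := ⇑(Equiv.ofBijective G.Orow G.hO).symm
  Xrow := ⇑(Equiv.ofBijective G.Xrow G.hX).symm
  hO := (Equiv.ofBijective G.Orow G.hO).symm.bijective
  hX := (Equiv.ofBijective G.Xrow G.hX).symm.bijective
  hOX := by
    intro i h
    apply G.hOX ((Equiv.ofBijective G.Orow G.hO).symm i)
    have h1 : G.Orow ((Equiv.ofBijective G.Orow G.hO).symm i) = i :=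
      Equiv.ofBijective_apply_symm_apply G.Orow G.hO i
    have h2 : G.Xrow ((Equiv.ofBijective G.Xrow G.hX).symm i) = i :=
      Equiv.ofBijective_apply_symm_apply G.Xrow G.hX i
    rw [h1, h, h2]

/-- `𝔾` and `𝔾'` differ by a row commutation move -/
def IsRowComm {n : ℕ} (G G' : GridDiagram n) : Prop :=
  IsColComm G.transpose G'.transpose

/-- collapse map identifying `a` and `a+1` (used to destabilize) -/
def coll {n : ℕ} (a k : ZMod (n + 1)) : ZMod n :=
  (a.val : ZMod n) + (((k - a).val - 1 : ℕ) : ZMod n)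

/-- `𝔾'` is obtained from `𝔾` by a stabilization with new 2×2 block at columns
`c', c'+1` and rows `r', r'+1`; the empty square of the block sits at the corner
selected by `(ec, er)` (east column?, north row?), and `xty` records whether the
block carries two `X`-markings (type `X:·`) or two `O`-markings (type `O:·`).
E.g. `(ec, er, xty) = (false, false, true)` is type `X:SW`, with
`O₁ = (c'+1, r'+1)`, `X₁ = (c', r'+1)`, `X₂ = (c'+1, r')`. -/
def IsStabAt {n : ℕ} (G : GridDiagram n) (G' : GridDiagram (n + 1))
    (c' r' : ZMod (n + 1)) (ec er xty : Bool) : Prop :=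
  (if xty then
    G'.Orow (if ec then c' else c' + 1) = (if er then r' else r' + 1) ∧
    G'.Xrow (if ec then c' + 1 else c') = (if er then r' else r' + 1) ∧
    G'.Xrow (if ec then c' else c' + 1) = (if er then r' + 1 else r') ∧
    G.Xrow (c'.val : ZMod n) = (r'.val : ZMod n) ∧
    G.Orow (c'.val : ZMod n) = coll r' (G'.Orow (if ec then c' + 1 else c'))
  else
    G'.Xrow (if ec then c' else c' + 1) = (if er then r' else r' + 1) ∧
    G'.Orow (if ec then c' + 1 else c') = (if er then r' else r' + 1) ∧
    G'.Orow (if ec then c' else c' + 1) = (if er then r' + 1 else r') ∧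
    G.Orow (c'.val : ZMod n) = (r'.val : ZMod n) ∧
    G.Xrow (c'.val : ZMod n) = coll r' (G'.Xrow (if ec then c' + 1 else c'))) ∧
  (∀ k : ZMod (n + 1), k ≠ c' → k ≠ c' + 1 →
    G.Orow (coll c' k) = coll r' (G'.Orow k) ∧ G.Xrow (coll c' k) = coll r' (G'.Xrow k))

/-- `𝔾'` is obtained from `𝔾` by a stabilization move of one of the standard types -/
def IsStab {n : ℕ} (G : GridDiagram n) (G' : GridDiagram (n + 1)) : Prop :=
  ∃ c' r' ec er xty, IsStabAt G G' c' r' ec er xty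

/-! ### The stabilization machinery (type `X:SW`) for the 4-fold complexes -/

/-- projection of `GC•(𝔾₄')` onto the span `I₄` of states containing the
distinguished point `c = (c'+1, r'+1)` -/
def pI {n : ℕ} (c' r' : ZMod (n + 1)) : GC (n + 1) →ₗ[Rng (n + 1)] GC (n + 1) :=
  basisMap fun x => if x (c' + 1) = r' + 1 then Finsupp.single x 1 else 0

/-- projection onto the complementary span `N₄` -/
def pN {n : ℕ} (c' r' : ZMod (n + 1)) : GC (n + 1) →ₗ[Rng (n + 1)] GC (n + 1) :=
  basisMap fun x => if x (c' + 1) = r' + 1 then 0 else Finsupp.single x 1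

/-- the submodule `I₄` -/
def Isub {n : ℕ} (c' r' : ZMod (n + 1)) : Submodule (Rng (n + 1)) (GC (n + 1)) :=
  Finsupp.supported (Rng (n + 1)) (Rng (n + 1)) {x : GridState (n + 1) | x (c' + 1) = r' + 1}

/-- the submodule `N₄` -/
def Nsub {n : ℕ} (c' r' : ZMod (n + 1)) : Submodule (Rng (n + 1)) (GC (n + 1)) :=
  Finsupp.supported (Rng (n + 1)) (Rng (n + 1)) {x : GridState (n + 1) | x (c' + 1) ≠ r' + 1}

/-- the components `∂_{I₄}^{I₄}`, `∂_{I₄}^{N₄}`, `∂_{N₄}^{N₄}` of `∂₄•` -/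
def dII {n : ℕ} [NeZero (n + 1)] (G' : GridDiagram (n + 1)) (c' r' : ZMod (n + 1)) :
    GC (n + 1) →ₗ[Rng (n + 1)] GC (n + 1) :=
  pI c' r' ∘ₗ diff4 G' ∘ₗ pI c' r'

def dIN {n : ℕ} [NeZero (n + 1)] (G' : GridDiagram (n + 1)) (c' r' : ZMod (n + 1)) :
    GC (n + 1) →ₗ[Rng (n + 1)] GC (n + 1) :=
  pN c' r' ∘ₗ diff4 G' ∘ₗ pI c' r'

def dNN {n : ℕ} [NeZero (n + 1)] (G' : GridDiagram (n + 1)) (c' r' : ZMod (n + 1)) :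
    GC (n + 1) →ₗ[Rng (n + 1)] GC (n + 1) :=
  pN c' r' ∘ₗ diff4 G' ∘ₗ pN c' r'

/-- section of the column collapse map, avoiding the new column `c'+1` -/
def sect {n : ℕ} (a : ZMod (n + 1)) (k : ZMod n) : ZMod (n + 1) :=
  a + (if k - (a.val : ZMod n) = 0 then 0
       else (((k - (a.val : ZMod n)).val + 1 : ℕ) : ZMod (n + 1)))

def stCollFun {n : ℕ} (c' r' : ZMod (n + 1)) (x : GridState (n + 1)) :
    ZMod n → ZMod n :=
  fun k => coll r' (x (sect c' k))

/-- the destabilized grid state `x` corresponding to `x' = x ∪ {c}` -/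
def stColl {n : ℕ} (c' r' : ZMod (n + 1)) (x : GridState (n + 1)) : GridState n :=
  if h : Function.Bijective (stCollFun c' r' x) then Equiv.ofBijective _ h else 1

/-- the promoted module `GC•(𝔾₄)[V₁]`: the free `𝔽[V₁,…,V_n,v]`-module on the
grid states of the destabilized diagram -/
abbrev GCP (n : ℕ) := GridState n →₀ Rng (n + 1)

def basisMapP {n : ℕ} (f : GridState n → GCP n) : GCP n →ₗ[Rng (n + 1)] GCP n :=
  Finsupp.lsum (Rng (n + 1)) fun x => LinearMap.toSpanSingleton (Rng (n + 1)) (GCP n) (f x)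

/-- the identification `e₄` (extended by zero on `N₄`) -/
def e4map {n : ℕ} (c' r' : ZMod (n + 1)) : GC (n + 1) →ₗ[Rng (n + 1)] GCP n :=
  Finsupp.lsum (Rng (n + 1)) fun x =>
    LinearMap.toSpanSingleton (Rng (n + 1)) (GCP n)
      (if x (c' + 1) = r' + 1 then Finsupp.single (stColl c' r' x) (1 : Rng (n + 1)) else 0)

/-- renaming of the variables of the destabilized diagram into those of `𝔾'` -/
def renUp {n : ℕ} (c' : ZMod (n + 1)) : Rng n →+* Rng (n + 1) :=
  (MvPolynomial.rename (Option.map (sect c')) :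
      MvPolynomial (Option (ZMod n)) F →ₐ[F] MvPolynomial (Option (ZMod (n + 1))) F).toRingHom

/-- the differential of the promoted complex `GC•(𝔾₄)[V₁]` -/
def diffP {n : ℕ} [NeZero n] (G : GridDiagram n) (c' : ZMod (n + 1)) :
    GCP n →ₗ[Rng (n + 1)] GCP n :=
  basisMapP fun x => ∑ y : GridState n,
    ∑ r ∈ Finset.univ.filter
        (fun r : Rect (2 * n) => IsRect4From x y r ∧ normal4 r ∧ XDisjoint4 G r),
      Finsupp.single y (renUp c' (wt4 G x y r))

/-- homogeneity on the promoted complex -/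
def IsHomogP {n : ℕ} [NeZero n] (G : GridDiagram n) (z : GCP n) (d s : ℚ) : Prop :=
  ∀ (y : GridState n) (k : Option (ZMod (n + 1)) →₀ ℕ), MvPolynomial.coeff k (z y) ≠ 0 →
    (MaslovO G y - 2 * ∑ i : ZMod (n + 1), (k (some i) : ℚ) + 2 * (k none : ℚ) = d) ∧
    (Alex G y - ∑ i : ZMod (n + 1), (k (some i) : ℚ) = s)

/-- the map counting equivalence classes of rectangles crossing `X₂` (the
`X`-marking of column `c'+1`) once and no other `X`-marking -/
def HX2map {n : ℕ} (G' : GridDiagram (n + 1)) (c' : ZMod (n + 1)) :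
    GC (n + 1) →ₗ[Rng (n + 1)] GC (n + 1) :=
  basisMap fun x => ∑ y : GridState (n + 1),
    ∑ r ∈ Finset.univ.filter (fun r : Rect (2 * (n + 1)) =>
        IsRect4From x y r ∧ normal4 r ∧ X4count G' r (c' + 1) = 1 ∧
        ∀ k, k ≠ c' + 1 → X4count G' r k = 0),
      Finsupp.single y (wt4 G' x y r)

/-- its component `𝓗_{X₂}^{I₄} : N₄ → I₄` -/
def hX2I {n : ℕ} (G' : GridDiagram (n + 1)) (c' r' : ZMod (n + 1)) :
    GC (n + 1) →ₗ[Rng (n + 1)] GC (n + 1) :=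
  pI c' r' ∘ₗ HX2map G' c' ∘ₗ pN c' r'

/-- weight with the variable `V_j` evaluated at `1` -/
def wtNo {n : ℕ} [NeZero n] (G : GridDiagram n) (x y : GridState n) (j : ZMod n)
    (r : Rect (2 * n)) : Rng n :=
  (∏ i ∈ Finset.univ.erase j, Vv i ^ O4count G r i) * vV ^ m4 x y r

/-- `𝓗_{O₁}•`: counts `X`-disjoint rectangles crossing `O₁` (the `O`-marking of
column `c'+1`) once, with `V₁` evaluated at `1` -/
def HO1map {n : ℕ} (G' : GridDiagram (n + 1)) (c' : ZMod (n + 1)) :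
    GC (n + 1) →ₗ[Rng (n + 1)] GC (n + 1) :=
  basisMap fun x => ∑ y : GridState (n + 1),
    ∑ r ∈ Finset.univ.filter (fun r : Rect (2 * (n + 1)) =>
        IsRect4From x y r ∧ normal4 r ∧ XDisjoint4 G' r ∧ O4count G' r (c' + 1) = 1),
      Finsupp.single y (wtNo G' x y (c' + 1) r)

/-- its component `I₄ → N₄` -/
def hO1N {n : ℕ} (G' : GridDiagram (n + 1)) (c' r' : ZMod (n + 1)) :
    GC (n + 1) →ₗ[Rng (n + 1)] GC (n + 1) :=
  pN c' r' ∘ₗ HO1map G' c' ∘ₗ pI c' r'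

/-! ### Grid diagrams of arbitrary size, and the moves of Cromwell's theorem -/

/-- a grid diagram of unspecified (positive) grid number -/
structure GDS where
  sz : ℕ+
  D : GridDiagram (sz : ℕ)

instance (p : ℕ+) : NeZero (p : ℕ) := ⟨p.ne_zero⟩

/-- a single commutation or stabilization move -/
def MoveRel (A B : GDS) : Prop :=
  (∃ h : (A.sz : ℕ) = (B.sz : ℕ),
      IsColComm (h ▸ A.D) B.D ∨ IsRowComm (h ▸ A.D) B.D) ∨
  (∃ h : (B.sz : ℕ) = (A.sz : ℕ) + 1, IsStab A.D (h ▸ B.D))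

/-- connected by a finite sequence of commutation moves and
stabilization/destabilization moves -/
def ConnectedByMoves (A B : GDS) : Prop :=
  Relation.ReflTransGen (fun X Y => MoveRel X Y ∨ MoveRel Y X) A B


/-! ### Elementary facts on `ZMod` -/

lemma zval_sub {m : ℕ} [NeZero m] (a b : ZMod m) :
    (a - b).val = if b.val ≤ a.val then a.val - b.val else a.val + m - b.val := by
  split_ifs with h
  · exact ZMod.val_sub h
  · have h1 : b - a ≠ 0 := by
      intro h0
      rw [sub_eq_zero] at h0
      rw [h0] at h; exact h le_rfl
    have h2 : (b - a).val = b.val - a.val := ZMod.val_sub (by omega)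
    have h3 : a - b = -(b - a) := by ring
    have : NeZero (b - a) := ⟨h1⟩
    rw [h3, ZMod.val_neg_of_ne_zero, h2]
    have := ZMod.val_lt b
    omega

lemma zval_cast_lt {m : ℕ} [NeZero m] {t : ℕ} (h : t < m) : ((t : ℕ) : ZMod m).val = t := by
  rw [ZMod.val_natCast]; exact Nat.mod_eq_of_lt h

lemma zcast_val {m : ℕ} [NeZero m] (a : ZMod m) : ((a.val : ℕ) : ZMod m) = a :=
  ZMod.natCast_zmod_val a

lemma pr_add {n : ℕ} (a b : ZMod (2 * n)) : pr (a + b) = pr a + pr b := by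
  simp [pr]

lemma pr_sub {n : ℕ} (a b : ZMod (2 * n)) : pr (a - b) = pr a - pr b := by
  simp [pr]

lemma pr_one {n : ℕ} : pr (1 : ZMod (2 * n)) = 1 := by
  simp [pr]

lemma pr_nat {n : ℕ} (t : ℕ) : pr ((t : ℕ) : ZMod (2 * n)) = (t : ZMod n) := by
  simp [pr]

lemma pr_val {n : ℕ} [NeZero n] (a : ZMod (2 * n)) : (pr a).val = a.val % n := by
  conv_lhs => rw [← zcast_val a]
  rw [pr_nat, ZMod.val_natCast]

lemma pr_val_lt {n : ℕ} [NeZero n] (a : ZMod (2 * n)) (h : a.val < n) : (pr a).val = a.val := by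
  rw [pr_val]; exact Nat.mod_eq_of_lt h

lemma pr_surj {n : ℕ} [NeZero n] (i : ZMod n) : ∃ a : ZMod (2 * n), pr a = i :=
  ⟨(i.val : ZMod (2 * n)), by rw [pr_nat, zcast_val]⟩

lemma pr_eq_zero {n : ℕ} [NeZero n] (a : ZMod (2 * n)) : pr a = 0 ↔ a = 0 ∨ a = (n : ZMod (2 * n)) := by
  have hn : 0 < n := Nat.pos_of_ne_zero (NeZero.ne n)
  constructor
  · intro h
    have h1 : a.val % n = 0 := by rw [← pr_val, h, ZMod.val_zero]
    have h2 := ZMod.val_lt a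
    obtain ⟨q, hq⟩ := Nat.dvd_of_mod_eq_zero h1
    have hq2 : q < 2 := by
      by_contra hc
      have : n * 2 ≤ n * q := Nat.mul_le_mul_left n (by omega)
      omega
    interval_cases q
    · left; rw [← zcast_val a, hq]; simp
    · right; rw [← zcast_val a, hq]; simp
  · rintro (rfl | rfl)
    · simp [pr]
    · rw [pr_nat]; simp

lemma n_ne_zero2 {n : ℕ} [NeZero n] : ((n : ℕ) : ZMod (2 * n)) ≠ 0 := by
  have hn : 0 < n := Nat.pos_of_ne_zero (NeZero.ne n)
  intro h
  have := zval_cast_lt (m := 2 * n) (t := n) (by omega)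
  rw [h, ZMod.val_zero] at this
  omega

lemma pr_eq_iff {n : ℕ} [NeZero n] (a b : ZMod (2 * n)) :
    pr a = pr b ↔ a = b ∨ a = b + (n : ZMod (2 * n)) := by
  rw [← sub_eq_zero, ← pr_sub, pr_eq_zero, sub_eq_zero, sub_eq_iff_eq_add, add_comm b]

/-- the projection of a rectangle to the base torus -/
def prR {n : ℕ} (r : Rect (2 * n)) : Rect n := ⟨pr r.cW, pr r.cE, pr r.rS, pr r.rN⟩

/-- small rectangles: those of width and height less than `n` -/
def Small {n : ℕ} (r : Rect (2 * n)) : Prop :=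
  (r.cE - r.cW).val < n ∧ (r.rN - r.rS).val < n

lemma sum_fiber {n : ℕ} [NeZero n] {M : Type*} [AddCommMonoid M] (u v : ZMod (2 * n))
    (hw : (v - u).val < n) (h : ZMod n → M) :
    (∑ a : ZMod (2 * n), if inIco u v a then h (pr a) else 0) =
      ∑ i : ZMod n, if inIco (pr u) (pr v) i then h i else 0 := by
  have hn : 0 < n := Nat.pos_of_ne_zero (NeZero.ne n)
  rw [← Finset.sum_filter, ← Finset.sum_filter]
  have hvu : (pr v - pr u).val = (v - u).val := by rw [← pr_sub, pr_val_lt _ hw]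
  refine Finset.sum_nbij' pr (fun i => u + (((i - pr u).val : ℕ) : ZMod (2 * n))) ?_ ?_ ?_ ?_ ?_
  · intro a ha
    simp only [Finset.mem_filter, Finset.mem_univ, true_and] at ha ⊢
    unfold inIco at *
    rw [hvu, ← pr_sub, pr_val_lt _ (by omega)]; exact ha
  · intro i hi
    simp only [Finset.mem_filter, Finset.mem_univ, true_and] at hi ⊢
    unfold inIco at *
    rw [add_sub_cancel_left, zval_cast_lt (by omega)]; omega
  · intro a ha
    simp only [Finset.mem_filter, Finset.mem_univ, true_and] at ha
    unfold inIco at *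
    rw [← pr_sub, pr_val_lt _ (by omega), zcast_val]; ring
  · intro i hi
    rw [pr_add, pr_nat, zcast_val]; ring
  · intros; rfl

lemma mult_cast {m : ℕ} {K : Type*} [CommSemiring K] (r : Rect m) (a b : ZMod m) :
    ((r.mult (a, b) : ℕ) : K) =
      (if inIco r.cW r.cE a then 1 else 0) * (if inIco r.rS r.rN b then 1 else 0) := by
  unfold Rect.mult
  by_cases h1 : inIco r.cW r.cE a <;> by_cases h2 : inIco r.rS r.rN b <;> simp [h1, h2]

lemma sum_mult {n : ℕ} [NeZero n] {K : Type*} [CommSemiring K] (r : Rect (2 * n)) (hr : Small r)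
    (g : ZMod n → ZMod n → K) :
    (∑ p : ZMod (2 * n) × ZMod (2 * n), ((r.mult p : ℕ) : K) * g (pr p.1) (pr p.2)) =
      ∑ i : ZMod n, ∑ j : ZMod n, (((prR r).mult (i, j) : ℕ) : K) * g i j := by
  rw [Fintype.sum_prod_type]
  simp only [mult_cast]
  have h1 : ∀ a : ZMod (2 * n), (∑ b : ZMod (2 * n),
      (if inIco r.cW r.cE a then (1 : K) else 0) * (if inIco r.rS r.rN b then 1 else 0) *
        g (pr a) (pr b)) =
      if inIco r.cW r.cE a then
        (fun i => ∑ j : ZMod n, if inIco (pr r.rS) (pr r.rN) j then g i j else 0) (pr a) else 0 := by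
    intro a
    split_ifs with h
    · simp only
      rw [← sum_fiber r.rS r.rN hr.2 (fun j => g (pr a) j)]
      refine Finset.sum_congr rfl fun b _ => ?_
      split_ifs <;> simp
    · simp
  rw [Finset.sum_congr rfl fun a _ => h1 a, sum_fiber r.cW r.cE hr.1
    (fun i => ∑ j : ZMod n, if inIco (pr r.rS) (pr r.rN) j then g i j else 0)]
  refine Finset.sum_congr rfl fun i _ => ?_
  change _ = ∑ j : ZMod n, ((if inIco (pr r.cW) (pr r.cE) i then (1 : K) else 0) *
    (if inIco (pr r.rS) (pr r.rN) j then 1 else 0)) * g i j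
  split_ifs with h
  · refine Finset.sum_congr rfl fun b _ => ?_
    split_ifs <;> simp
  · simp

lemma sum_ind {n : ℕ} [NeZero n] {K : Type*} [CommSemiring K] (f : ZMod n → ZMod n → K)
    (i0 j0 : ZMod n) :
    (∑ i, ∑ j, f i j * (if i = i0 ∧ j = j0 then 1 else 0)) = f i0 j0 := by
  rw [Finset.sum_eq_single i0, Finset.sum_eq_single j0]
  · simp
  · intro b _ hb; simp [hb]
  · simp
  · intro b _ hb; simp [hb]
  · simp

lemma cnt4_eq {n : ℕ} [NeZero n] (r : Rect (2 * n)) (hr : Small r) (i j : ZMod n) :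
    (∑ p : ZMod (2 * n) × ZMod (2 * n), if pr p.1 = i ∧ pr p.2 = j then r.mult p else 0) =
      (prR r).mult (i, j) := by
  have := sum_mult (K := ℕ) r hr (fun a b => if a = i ∧ b = j then 1 else 0)
  rw [sum_ind] at this
  simp only [Nat.cast_id] at this
  rw [← this]
  refine Finset.sum_congr rfl fun p _ => ?_
  split_ifs <;> simp

lemma O4count_eq {n : ℕ} [NeZero n] (G : GridDiagram n) (r : Rect (2 * n)) (hr : Small r)
    (i : ZMod n) : O4count G r i = Ocount G (prR r) i := cnt4_eq r hr i _

lemma X4count_eq {n : ℕ} [NeZero n] (G : GridDiagram n) (r : Rect (2 * n)) (hr : Small r)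
    (i : ZMod n) : X4count G r i = Xcount G (prR r) i := cnt4_eq r hr i _

lemma pm_shift {n : ℕ} [NeZero n] (w : GridState n) (r : Rect (2 * n)) (hr : Small r)
    (d e : ZMod (2 * n)) :
    (∑ p : ZMod (2 * n) × ZMod (2 * n),
      if w (pr p.1) = pr p.2 then ((r.mult (p.1 - d, p.2 - e) : ℕ) : ℚ) else 0) =
      ∑ k : ZMod n, (((prR r).mult (k - pr d, w k - pr e) : ℕ) : ℚ) := by
  have h1 := sum_mult (K := ℚ) r hr (fun a b => if w (a + pr d) = b + pr e then 1 else 0)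
  have h2 : (∑ p : ZMod (2 * n) × ZMod (2 * n),
      if w (pr p.1) = pr p.2 then ((r.mult (p.1 - d, p.2 - e) : ℕ) : ℚ) else 0) =
      ∑ p : ZMod (2 * n) × ZMod (2 * n), ((r.mult p : ℕ) : ℚ) *
        (fun a b => if w (a + pr d) = b + pr e then 1 else 0) (pr p.1) (pr p.2) := by
    refine Fintype.sum_equiv (Equiv.prodCongr (Equiv.subRight d) (Equiv.subRight e)) _ _ ?_
    rintro ⟨a, b⟩
    simp [pr_sub]
  rw [h2, h1]
  refine Fintype.sum_equiv (Equiv.addRight (pr d)) _ _ ?_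
  intro i
  rw [Finset.sum_eq_single (w (i + pr d) - pr e)]
  · simp
  · intro b _ hb
    have : ¬ (w (i + pr d) = b + pr e) := fun h => hb (by rw [h]; ring)
    simp [this]
  · simp

lemma rpm4_eq {n : ℕ} [NeZero n] (w : GridState n) (r : Rect (2 * n)) (hr : Small r) :
    rpm4 w r = Rect.pm w (prR r) := by
  have h00 := pm_shift w r hr 0 0
  have h10 := pm_shift w r hr 1 0
  have h01 := pm_shift w r hr 0 1
  have h11 := pm_shift w r hr 1 1
  have p0 : pr (0 : ZMod (2 * n)) = 0 := by simp [pr]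
  simp only [p0, pr_one, sub_zero] at h00 h10 h01 h11
  unfold rpm4 pm4 Rect.pm Rect.dom4
  congr 1
  push_cast
  simp only [Finset.sum_add_distrib]
  rw [← h00, ← h10, ← h01, ← h11]
  simp only [← Finset.sum_add_distrib]
  refine Finset.sum_congr rfl fun p _ => ?_
  split_ifs <;> simp


/-! ### Point measures on the base torus -/

lemma val_pos_of_ne {m : ℕ} [NeZero m] {a b : ZMod m} (h : a ≠ b) : 0 < (a - b).val := by
  rcases Nat.eq_zero_or_pos (a - b).val with h0 | h0
  · exact absurd (sub_eq_zero.mp ((ZMod.val_eq_zero _).mp h0)) h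
  · exact h0

lemma sub_val_inj {m : ℕ} [NeZero m] {a b u : ZMod m} (h : (a - u).val = (b - u).val) : a = b :=
  sub_left_injective (ZMod.val_injective m h)

lemma chi_sum {m : ℕ} [NeZero m] (u v k : ZMod m) (h : u ≠ v) :
    (if inIco u v (k - 1) then 1 else 0) + (if inIco u v k then 1 else 0) =
      if inIoo u v k then 2 else if k = u ∨ k = v then 1 else 0 := by
  have hw := val_pos_of_ne h.symm
  have hwm := ZMod.val_lt (v - u)
  have htm := ZMod.val_lt (k - u)
  have h1 : (1 : ZMod m).val = 1 := by
    have := zval_cast_lt (m := m) (t := 1) (by omega)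
    simpa using this
  have hu : k = u ↔ (k - u).val = 0 := by
    rw [ZMod.val_eq_zero, sub_eq_zero]
  have hv : k = v ↔ (k - u).val = (v - u).val :=
    ⟨fun e => by rw [e], sub_val_inj⟩
  have hk : (k - 1 - u).val = if 1 ≤ (k - u).val then (k - u).val - 1 else (k - u).val + m - 1 := by
    have e : k - 1 - u = k - u - 1 := by ring
    rw [e, zval_sub, h1]
  have i1 : inIco u v (k - 1) ↔ (if 1 ≤ (k - u).val then (k - u).val - 1
      else (k - u).val + m - 1) < (v - u).val := by unfold inIco; rw [hk]
  have i2 : inIco u v k ↔ (k - u).val < (v - u).val := Iff.rfl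
  have i3 : inIoo u v k ↔ 0 < (k - u).val ∧ (k - u).val < (v - u).val := Iff.rfl
  simp only [i1, i2, i3, hu, hv]
  split_ifs <;> omega

lemma not_inIoo_left {m : ℕ} [NeZero m] (u v : ZMod m) : ¬ inIoo u v u := by
  unfold inIoo; simp

lemma not_inIoo_right {m : ℕ} [NeZero m] (u v : ZMod m) : ¬ inIoo u v v := by
  unfold inIoo; simp

lemma pm_eq {m : ℕ} [NeZero m] (w : GridState m) (r : Rect m) (h1 : r.cW ≠ r.cE)
    (h2 : r.rS ≠ r.rN)
    (hw : (w r.cW = r.rS ∧ w r.cE = r.rN) ∨ (w r.cW = r.rN ∧ w r.cE = r.rS)) :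
    Rect.pm w r = Rect.intCount w r + 1 / 2 := by
  have key : ∀ k : ZMod m, r.mult (k - 1, w k - 1) + r.mult (k, w k - 1) +
      r.mult (k - 1, w k) + r.mult (k, w k) =
      (if inIoo r.cW r.cE k ∧ inIoo r.rS r.rN (w k) then 4 else 0) +
        (if k = r.cW then 1 else 0) + (if k = r.cE then 1 else 0) := by
    intro k
    have e : r.mult (k - 1, w k - 1) + r.mult (k, w k - 1) +
      r.mult (k - 1, w k) + r.mult (k, w k) =
      ((if inIco r.cW r.cE (k - 1) then 1 else 0) + (if inIco r.cW r.cE k then 1 else 0)) *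
      ((if inIco r.rS r.rN (w k - 1) then 1 else 0) + (if inIco r.rS r.rN (w k) then 1 else 0)) := by
      have h := fun a b => mult_cast (K := ℕ) r a b
      simp only [Nat.cast_id] at h
      rw [h, h, h, h]; ring
    rw [e, chi_sum _ _ _ h1, chi_sum _ _ _ h2]
    have a1 := not_inIoo_left r.cW r.cE
    have a2 := not_inIoo_right r.cW r.cE
    have b1 := not_inIoo_left r.rS r.rN
    have b2 := not_inIoo_right r.rS r.rN
    by_cases k1 : k = r.cW
    · subst k1
      rcases hw with ⟨q1, q2⟩ | ⟨q1, q2⟩ <;> simp [a1, b1, b2, q1, h1]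
    by_cases k2 : k = r.cE
    · subst k2
      rcases hw with ⟨q1, q2⟩ | ⟨q1, q2⟩ <;> simp [a2, b1, b2, q2, h1.symm]
    have n1 : w k ≠ w r.cW := fun h => k1 (w.injective h)
    have n2 : w k ≠ w r.cE := fun h => k2 (w.injective h)
    have n3 : w k ≠ r.rS ∧ w k ≠ r.rN := by
      rcases hw with ⟨q1, q2⟩ | ⟨q1, q2⟩
      · exact ⟨q1 ▸ n1, q2 ▸ n2⟩
      · exact ⟨q2 ▸ n2, q1 ▸ n1⟩
    by_cases c1 : inIoo r.cW r.cE k <;> by_cases c2 : inIoo r.rS r.rN (w k) <;>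
      simp [c1, c2, k1, k2, n3.1, n3.2]
  unfold Rect.pm Rect.intCount
  simp only [key]
  rw [← Nat.cast_sum, Finset.sum_add_distrib, Finset.sum_add_distrib, ← Finset.sum_filter]
  simp only [Finset.sum_const, Finset.sum_ite_eq', Finset.mem_univ, if_true, smul_eq_mul]
  push_cast
  ring

lemma intCount_eq {m : ℕ} [NeZero m] (x y : GridState m) (r : Rect m) (h : IsRectFrom x y r) :
    Rect.intCount y r = Rect.intCount x r := by
  obtain ⟨h1, h2, x1, x2, y1, y2, hk⟩ := h
  unfold Rect.intCount
  congr 1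
  ext k
  simp only [Finset.mem_filter, Finset.mem_univ, true_and]
  refine and_congr_right fun hin => ?_
  have k1 : k ≠ r.cW := by rintro rfl; exact not_inIoo_left _ _ hin
  have k2 : k ≠ r.cE := by rintro rfl; exact not_inIoo_right _ _ hin
  rw [hk k k1 k2]

lemma m4_eq {n : ℕ} [NeZero n] (x y : GridState n) (r : Rect (2 * n)) (hr : Small r)
    (h : IsRectFrom x y (prR r)) : m4 x y r = Rect.intCount x (prR r) := by
  unfold m4 mQ4
  rw [rpm4_eq _ _ hr, rpm4_eq _ _ hr]
  have hy := intCount_eq x y _ h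
  obtain ⟨h1, h2, x1, x2, y1, y2, hk⟩ := h
  rw [pm_eq x _ h1 h2 (Or.inl ⟨x1, x2⟩), pm_eq y _ h1 h2 (Or.inr ⟨y1, y2⟩), hy]
  have : ((Rect.intCount x (prR r) : ℚ) + 1 / 2 + (Rect.intCount x (prR r) + 1 / 2) - 1) / 2 =
      ((Rect.intCount x (prR r) : ℤ) : ℚ) := by push_cast; ring
  rw [this, Int.floor_intCast]; simp

/-! ### Rectangles in the cover versus rectangles in the base -/

lemma small_of_xdisj {n : ℕ} [NeZero n] (G : GridDiagram n) (r : Rect (2 * n))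
    (h1 : r.cW ≠ r.cE) (h2 : r.rS ≠ r.rN) (hX : XDisjoint4 G r) : Small r := by
  have hn : 0 < n := Nat.pos_of_ne_zero (NeZero.ne n)
  have key : ∀ p : ZMod (2 * n) × ZMod (2 * n), pr p.2 = G.Xrow (pr p.1) → r.mult p = 0 := by
    intro p hp
    have := hX (pr p.1)
    unfold X4count at this
    rw [Finset.sum_eq_zero_iff] at this
    have := this p (Finset.mem_univ _)
    rwa [if_pos ⟨rfl, hp⟩] at this
  have lift : ∀ (u : ZMod (2 * n)) (i : ZMod n), ∃ a : ZMod (2 * n), pr a = i ∧ (a - u).val < n := by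
    intro u i
    refine ⟨u + (((i - pr u).val : ℕ) : ZMod (2 * n)), ?_, ?_⟩
    · rw [pr_add, pr_nat, zcast_val]; ring
    · have := ZMod.val_lt (i - pr u)
      rw [add_sub_cancel_left, zval_cast_lt (by omega)]; exact this
  have p1 := val_pos_of_ne h1.symm
  have p2 := val_pos_of_ne h2.symm
  constructor
  · by_contra hc
    obtain ⟨i, hi⟩ := G.hX.2 (pr r.rS)
    obtain ⟨a, ha, hlt⟩ := lift r.cW i
    have := key (a, r.rS) (by rw [ha, hi])
    unfold Rect.mult at this
    rw [if_pos] at this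
    · omega
    · refine ⟨?_, ?_⟩
      · unfold inIco; exact lt_of_lt_of_le hlt (by omega)
      · unfold inIco; simpa using p2
  · by_contra hc
    obtain ⟨b, hb, hlt⟩ := lift r.rS (G.Xrow (pr r.cW))
    have := key (r.cW, b) hb
    unfold Rect.mult at this
    rw [if_pos] at this
    · omega
    · refine ⟨?_, ?_⟩
      · unfold inIco; simpa using p1
      · unfold inIco; exact lt_of_lt_of_le hlt (by omega)

lemma corner_sum {n : ℕ} [NeZero n] (a b : ZMod (2 * n)) (p : ZMod (2 * n) × ZMod (2 * n)) :
    ((if p = (a, b) then (1 : ℤ) else 0) + (if p = (a, b + (n : ZMod (2 * n))) then 1 else 0)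
      + (if p = (a + (n : ZMod (2 * n)), b) then 1 else 0)
      + (if p = (a + (n : ZMod (2 * n)), b + (n : ZMod (2 * n))) then 1 else 0)) =
    if (pr p.1, pr p.2) = (pr a, pr b) then 1 else 0 := by
  obtain ⟨c, d⟩ := p
  have hn := n_ne_zero2 (n := n)
  simp only [Prod.mk.injEq, pr_eq_iff]
  by_cases c1 : c = a
  · subst c1
    by_cases d1 : d = b
    · subst d1; simp [hn]
    · by_cases d2 : d = b + (n : ZMod (2 * n))
      · subst d2; simp [hn]
      · simp [d1, d2]
  · by_cases c2 : c = a + (n : ZMod (2 * n))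
    · subst c2
      by_cases d1 : d = b
      · subst d1; simp [hn]
      · by_cases d2 : d = b + (n : ZMod (2 * n))
        · subst d2; simp [hn]
        · simp [d1, d2]
    · simp [c1, c2]

lemma cornerA_mk {m : ℕ} (a b c d : ZMod m) (p : ZMod m × ZMod m) :
    cornerA ⟨a, b, c, d⟩ p =
      (if p = (b, c) then 1 else 0) + (if p = (a, d) then 1 else 0)
        - (if p = (a, c) then 1 else 0) - (if p = (b, d) then 1 else 0) := rfl

lemma cornerA4 {n : ℕ} [NeZero n] (r : Rect (2 * n)) (p : ZMod (2 * n) × ZMod (2 * n)) :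
    cornerA r p + cornerA (trN r) p + cornerA (trE r) p + cornerA (trN (trE r)) p =
      cornerA (prR r) (pr p.1, pr p.2) := by
  have e1 := corner_sum r.cE r.rS p
  have e2 := corner_sum r.cW r.rN p
  have e3 := corner_sum r.cW r.rS p
  have e4 := corner_sum r.cE r.rN p
  obtain ⟨a, b, c, d⟩ := r
  simp only [trN, trE, prR, cornerA_mk]
  simp only at e1 e2 e3 e4
  rw [← e1, ← e2, ← e3, ← e4]
  ring

lemma cornerB_neg {m : ℕ} (r : Rect m) (p : ZMod m × ZMod m) : cornerB r p = - cornerA r p := by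
  unfold cornerA cornerB; ring

lemma isRect4_iff {n : ℕ} [NeZero n] (x y : GridState n) (r : Rect (2 * n)) :
    IsRect4From x y r ↔ r.cW ≠ r.cE ∧ r.rS ≠ r.rN ∧
      ∀ a b : ZMod n, cornerA (prR r) (a, b) =
        (if y a = b then 1 else 0) - (if x a = b then 1 else 0) := by
  unfold IsRect4From
  refine and_congr_right fun _ => and_congr_right fun _ => ?_
  constructor
  · rintro ⟨h, -⟩ a b
    obtain ⟨a', rfl⟩ := pr_surj a
    obtain ⟨b', rfl⟩ := pr_surj b
    have := h (a', b')
    rw [cornerA4] at this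
    exact this
  · intro h
    have hA : ∀ p, cornerA r p + cornerA (trN r) p + cornerA (trE r) p + cornerA (trN (trE r)) p
      = stInd y p - stInd x p := fun p => by
      rw [cornerA4, h]; rfl
    refine ⟨hA, fun p => ?_⟩
    simp only [cornerB_neg]
    have := hA p
    linarith

lemma isRectFrom_iff {m : ℕ} [NeZero m] (x y : GridState m) (r : Rect m) (h1 : r.cW ≠ r.cE)
    (h2 : r.rS ≠ r.rN) :
    IsRectFrom x y r ↔ ∀ a b : ZMod m, cornerA r (a, b) =
        (if y a = b then 1 else 0) - (if x a = b then 1 else 0) := by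
  constructor
  · rintro ⟨-, -, x1, x2, y1, y2, hk⟩ a b
    unfold cornerA
    simp only [Prod.mk.injEq]
    by_cases a1 : a = r.cW
    · subst a1
      rw [x1, y1]
      simp [h1, eq_comm]
    by_cases a2 : a = r.cE
    · subst a2
      rw [x2, y2]
      simp [h1.symm, eq_comm]
    rw [hk a a1 a2]
    simp [a1, a2]
  · intro h
    have q1 := h r.cW r.rS
    have q2 := h r.cE r.rN
    have q3 := h r.cW r.rN
    have q4 := h r.cE r.rS
    unfold cornerA at q1 q2 q3 q4
    simp only [Prod.mk.injEq, h1, h2, h1.symm, h2.symm, and_true, and_false, true_and, false_and,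
      if_true, if_false] at q1 q2 q3 q4
    refine ⟨h1, h2, ?_, ?_, ?_, ?_, ?_⟩
    · by_contra hc; rw [if_neg hc] at q1; split_ifs at q1 <;> omega
    · by_contra hc; rw [if_neg hc] at q2; split_ifs at q2 <;> omega
    · by_contra hc; rw [if_neg hc] at q3; split_ifs at q3 <;> omega
    · by_contra hc; rw [if_neg hc] at q4; split_ifs at q4 <;> omega
    · intro k k1 k2
      have q := h k (x k)
      unfold cornerA at q
      simp only [Prod.mk.injEq, k1, k2, false_and, if_false, if_true] at q
      by_contra hc
      rw [if_neg (fun e => hc e.symm)] at q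
      omega

/-- the lift of a rectangle of the base -/
def liftR {n : ℕ} (r : Rect n) : Rect (2 * n) :=
  ⟨(r.cW.val : ZMod (2 * n)), (r.cW.val : ZMod (2 * n)) + ((r.cE - r.cW).val : ZMod (2 * n)),
    (r.rS.val : ZMod (2 * n)), (r.rS.val : ZMod (2 * n)) + ((r.rN - r.rS).val : ZMod (2 * n))⟩

lemma prR_liftR {n : ℕ} [NeZero n] (r : Rect n) : prR (liftR r) = r := by
  obtain ⟨a, b, c, d⟩ := r
  simp only [prR, liftR, pr_add, pr_nat, zcast_val, add_sub_cancel]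

lemma small_liftR {n : ℕ} [NeZero n] (r : Rect n) : Small (liftR r) := by
  have h1 := ZMod.val_lt (r.cE - r.cW)
  have h2 := ZMod.val_lt (r.rN - r.rS)
  unfold Small liftR
  simp only [add_sub_cancel_left]
  rw [zval_cast_lt (by omega), zval_cast_lt (by omega)]
  exact ⟨h1, h2⟩

lemma normal_liftR {n : ℕ} [NeZero n] (r : Rect n) : normal4 (liftR r) := by
  have h1 := ZMod.val_lt r.cW
  have h2 := ZMod.val_lt r.rS
  unfold normal4 liftR
  simp only
  rw [zval_cast_lt (by omega), zval_cast_lt (by omega)]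
  exact ⟨h1, h2⟩

lemma liftR_prR {n : ℕ} [NeZero n] (r : Rect (2 * n)) (hr : Small r) (hn : normal4 r) :
    liftR (prR r) = r := by
  obtain ⟨a, b, c, d⟩ := r
  simp only [Small, normal4] at hr hn
  simp only [prR, liftR]
  rw [pr_val_lt _ hn.1, pr_val_lt _ hn.2, ← pr_sub, ← pr_sub, pr_val_lt _ hr.1, pr_val_lt _ hr.2,
    zcast_val, zcast_val, zcast_val, zcast_val]
  simp

lemma pr_ne_of_small {n : ℕ} [NeZero n] {a b : ZMod (2 * n)} (h : a ≠ b) (hs : (b - a).val < n) :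
    pr a ≠ pr b := by
  intro e
  have h1 := pr_val_lt _ hs
  have h2 := val_pos_of_ne h.symm
  rw [pr_sub, e, sub_self, ZMod.val_zero] at h1
  omega

/-- sums over rectangles of the cover are sums over rectangles of the base -/
lemma sum_rect4 {n : ℕ} [NeZero n] {M : Type*} [AddCommMonoid M] (G : GridDiagram n)
    (x y : GridState n) (g : Rng n → M) :
    (∑ r ∈ Finset.univ.filter
        (fun r : Rect (2 * n) => IsRect4From x y r ∧ normal4 r ∧ XDisjoint4 G r),
      g (wt4 G x y r)) =
    ∑ r ∈ Finset.univ.filter (fun r : Rect n => IsRectFrom x y r ∧ XDisjoint G r),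
      g (wtB G x r) := by
  have fwd : ∀ r : Rect (2 * n), IsRect4From x y r ∧ normal4 r ∧ XDisjoint4 G r →
      Small r ∧ IsRectFrom x y (prR r) ∧ XDisjoint G (prR r) := by
    rintro r ⟨h1, h2, h3⟩
    have h1' := (isRect4_iff x y r).mp h1
    have hs := small_of_xdisj G r h1'.1 h1'.2.1 h3
    refine ⟨hs, (isRectFrom_iff x y _ ?_ ?_).mpr h1'.2.2, ?_⟩
    · exact pr_ne_of_small h1'.1 hs.1
    · exact pr_ne_of_small h1'.2.1 hs.2
    · intro i; rw [← X4count_eq G r hs]; exact h3 i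
  refine Finset.sum_nbij' prR liftR ?_ ?_ ?_ ?_ ?_
  · intro r hr
    simp only [Finset.mem_filter, Finset.mem_univ, true_and] at hr ⊢
    exact (fwd r hr).2
  · intro r hr
    simp only [Finset.mem_filter, Finset.mem_univ, true_and] at hr ⊢
    obtain ⟨h1, h2⟩ := hr
    have hs := small_liftR r
    refine ⟨(isRect4_iff x y _).mpr ⟨?_, ?_, ?_⟩, normal_liftR r, ?_⟩
    · intro e
      have := congrArg pr e
      exact h1.1 (by rw [← prR_liftR r]; exact this)
    · intro e
      have := congrArg pr e
      exact h1.2.1 (by rw [← prR_liftR r]; exact this)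
    · rw [prR_liftR]
      exact (isRectFrom_iff x y r h1.1 h1.2.1).mp h1
    · intro i
      rw [X4count_eq G _ hs, prR_liftR]; exact h2 i
  · intro r hr
    simp only [Finset.mem_filter, Finset.mem_univ, true_and] at hr
    exact liftR_prR r (fwd r hr).1 hr.2.1
  · intro r _
    exact prR_liftR r
  · intro r hr
    simp only [Finset.mem_filter, Finset.mem_univ, true_and] at hr
    obtain ⟨hs, h1, h2⟩ := fwd r hr
    congr 1
    unfold wt4 wtB
    rw [m4_eq x y r hs h1]
    congr 1
    exact Finset.prod_congr rfl fun i _ => by rw [O4count_eq G r hs]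


/-! ### Stabilization: collapsing and sections -/

/-- effect of `sect` on offsets -/
def phi (i : ℕ) : ℕ := if i = 0 then 0 else i + 1

lemma one_val {n : ℕ} [NeZero n] : (1 : ZMod (n + 1)).val = 1 := by
  have hn : 0 < n := Nat.pos_of_ne_zero (NeZero.ne n)
  have := zval_cast_lt (m := n + 1) (t := 1) (by omega)
  simpa using this

lemma sect_val {n : ℕ} [NeZero n] (a : ZMod (n + 1)) (k : ZMod n) :
    (sect a k - a).val = phi (k - (a.val : ZMod n)).val := by
  unfold sect phi
  rw [add_sub_cancel_left]
  have hlt := ZMod.val_lt (k - (a.val : ZMod n))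
  by_cases h : k - (a.val : ZMod n) = 0
  · have e : (k - (a.val : ZMod n)).val = 0 := by rw [h]; exact ZMod.val_zero
    rw [if_pos h, if_pos e]; exact ZMod.val_zero
  · have h' : (k - (a.val : ZMod n)).val ≠ 0 := fun e => h ((ZMod.val_eq_zero _).mp e)
    rw [if_neg h, if_neg h', zval_cast_lt (by omega)]

lemma coll_val {n : ℕ} [NeZero n] (a k : ZMod (n + 1)) :
    (coll a k - (a.val : ZMod n)).val = (k - a).val - 1 := by
  have hn : 0 < n := Nat.pos_of_ne_zero (NeZero.ne n)
  have := ZMod.val_lt (k - a)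
  unfold coll
  rw [add_sub_cancel_left, zval_cast_lt (by omega)]

lemma eq_succ_iff {n : ℕ} [NeZero n] (a k : ZMod (n + 1)) : k = a + 1 ↔ (k - a).val = 1 := by
  have h : (a + 1 - a).val = 1 := by rw [add_sub_cancel_left, one_val]
  constructor
  · rintro rfl; exact h
  · intro e; exact sub_val_inj (e.trans h.symm)

lemma coll_sect {n : ℕ} [NeZero n] (a : ZMod (n + 1)) (k : ZMod n) : coll a (sect a k) = k := by
  apply sub_val_inj (u := (a.val : ZMod n))
  rw [coll_val, sect_val]; unfold phi; split_ifs <;> omega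

lemma sect_coll {n : ℕ} [NeZero n] (a k : ZMod (n + 1)) (h : k ≠ a + 1) :
    sect a (coll a k) = k := by
  apply sub_val_inj (u := a)
  rw [Ne, eq_succ_iff] at h
  rw [sect_val, coll_val]; unfold phi; split_ifs <;> omega

lemma sect_ne {n : ℕ} [NeZero n] (a : ZMod (n + 1)) (k : ZMod n) : sect a k ≠ a + 1 := by
  intro h
  rw [eq_succ_iff, sect_val] at h; unfold phi at h; split_ifs at h <;> omega

lemma sect_inj {n : ℕ} [NeZero n] (a : ZMod (n + 1)) : Function.Injective (sect a : ZMod n → _) :=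
  Function.LeftInverse.injective (coll_sect a)

lemma coll_self {n : ℕ} [NeZero n] (a : ZMod (n + 1)) : coll a a = (a.val : ZMod n) := by
  apply sub_val_inj (u := (a.val : ZMod n)); rw [coll_val]; simp

lemma coll_succ {n : ℕ} [NeZero n] (a : ZMod (n + 1)) : coll a (a + 1) = (a.val : ZMod n) := by
  apply sub_val_inj (u := (a.val : ZMod n))
  rw [coll_val, add_sub_cancel_left, one_val]; simp

lemma sub_val_rel {m : ℕ} [NeZero m] (a k u : ZMod m) :
    (k - u).val = if (u - a).val ≤ (k - a).val then (k - a).val - (u - a).val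
      else (k - a).val + m - (u - a).val := by
  rw [← zval_sub]; congr 1; ring

lemma inIco_coll {n : ℕ} [NeZero n] (a : ZMod (n + 1)) (u v : ZMod n) (k : ZMod (n + 1)) :
    inIco (sect a u) (sect a v) k ↔ inIco u v (coll a k) := by
  unfold inIco
  rw [sub_val_rel a k, sub_val_rel a (sect a v), sub_val_rel (a.val : ZMod n) (coll a k),
    sub_val_rel (a.val : ZMod n) v, sect_val, sect_val, coll_val]
  have h1 := ZMod.val_lt (u - (a.val : ZMod n))
  have h2 := ZMod.val_lt (v - (a.val : ZMod n))
  have h3 := ZMod.val_lt (k - a)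
  generalize (u - (a.val : ZMod n)).val = U at *
  generalize (v - (a.val : ZMod n)).val = V at *
  generalize (k - a).val = K at *
  unfold phi
  split_ifs <;> omega

lemma inIoo_iff {m : ℕ} [NeZero m] (u v k : ZMod m) : inIoo u v k ↔ k ≠ u ∧ inIco u v k := by
  have h : (k - u).val = 0 ↔ k = u := by rw [ZMod.val_eq_zero, sub_eq_zero]
  unfold inIoo inIco
  rw [Nat.pos_iff_ne_zero, Ne, h]

lemma inIoo_sect {n : ℕ} [NeZero n] (a : ZMod (n + 1)) (u v k : ZMod n) :
    inIoo (sect a u) (sect a v) (sect a k) ↔ inIoo u v k := by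
  rw [inIoo_iff, inIoo_iff, inIco_coll, coll_sect, (sect_inj a).ne_iff]

/-- all columns of the stabilized diagram: the new one and the old ones -/
def colE {n : ℕ} [NeZero n] (a : ZMod (n + 1)) : Option (ZMod n) ≃ ZMod (n + 1) where
  toFun o := o.elim (a + 1) (sect a)
  invFun k := if k = a + 1 then none else some (coll a k)
  left_inv o := by
    cases o with
    | none => simp
    | some k => simp [sect_ne, coll_sect]
  right_inv k := by
    by_cases h : k = a + 1
    · simp [h]
    · simp [h, sect_coll a k h]

lemma sum_sect {n : ℕ} [NeZero n] {M : Type*} [AddCommMonoid M] (a : ZMod (n + 1))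
    (f : ZMod (n + 1) → M) : ∑ k, f k = f (a + 1) + ∑ j : ZMod n, f (sect a j) := by
  rw [← Equiv.sum_comp (colE a), Fintype.sum_option]; rfl

lemma prod_sect {n : ℕ} [NeZero n] {M : Type*} [CommMonoid M] (a : ZMod (n + 1))
    (f : ZMod (n + 1) → M) : ∏ k, f k = f (a + 1) * ∏ j : ZMod n, f (sect a j) := by
  rw [← Equiv.prod_comp (colE a), Fintype.prod_option]; rfl

/-- the grid state `x ∪ {c}` -/
def stLift {n : ℕ} [NeZero n] (c' r' : ZMod (n + 1)) (x : GridState n) : GridState (n + 1) :=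
  ((colE c').symm.trans (Equiv.optionCongr x)).trans (colE r')

lemma stLift_c {n : ℕ} [NeZero n] (c' r' : ZMod (n + 1)) (x : GridState n) :
    stLift c' r' x (c' + 1) = r' + 1 := by
  have h : (colE c').symm (c' + 1) = none := by
    rw [Equiv.symm_apply_eq]; rfl
  simp only [stLift, Equiv.trans_apply, h]
  rfl

lemma stLift_sect {n : ℕ} [NeZero n] (c' r' : ZMod (n + 1)) (x : GridState n) (k : ZMod n) :
    stLift c' r' x (sect c' k) = sect r' (x k) := by
  have h : (colE c').symm (sect c' k) = some k := by
    rw [Equiv.symm_apply_eq]; rfl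
  simp only [stLift, Equiv.trans_apply, h]
  rfl

lemma stColl_stLift {n : ℕ} [NeZero n] (c' r' : ZMod (n + 1)) (x : GridState n) :
    stColl c' r' (stLift c' r' x) = x := by
  have h : stCollFun c' r' (stLift c' r' x) = x := by
    funext k
    unfold stCollFun
    rw [stLift_sect, coll_sect]
  have hb : Function.Bijective (stCollFun c' r' (stLift c' r' x)) := by
    rw [h]; exact x.bijective
  unfold stColl
  rw [dif_pos hb]
  ext k
  simp [h]

lemma stLift_stColl {n : ℕ} [NeZero n] (c' r' : ZMod (n + 1)) (x : GridState (n + 1))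
    (hx : x (c' + 1) = r' + 1) : stLift c' r' (stColl c' r' x) = x := by
  have hne : ∀ k : ZMod n, x (sect c' k) ≠ r' + 1 := fun k h =>
    sect_ne c' k (x.injective (h.trans hx.symm))
  have hinj : Function.Injective (stCollFun c' r' x) := by
    intro i j hij
    unfold stCollFun at hij
    have := congrArg (sect r') hij
    rw [sect_coll _ _ (hne i), sect_coll _ _ (hne j)] at this
    exact sect_inj c' (x.injective this)
  have hb : Function.Bijective (stCollFun c' r' x) := Finite.injective_iff_bijective.mp hinj
  have hs : ∀ k, stColl c' r' x k = coll r' (x (sect c' k)) := by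
    intro k
    unfold stColl
    rw [dif_pos hb]
    rfl
  apply Equiv.ext
  intro k
  by_cases hk : k = c' + 1
  · rw [hk, stLift_c, hx]
  · rw [← sect_coll c' k hk, stLift_sect, hs, sect_coll _ _ (hne _)]

def sectR {n : ℕ} (c' r' : ZMod (n + 1)) (R : Rect n) : Rect (n + 1) :=
  ⟨sect c' R.cW, sect c' R.cE, sect r' R.rS, sect r' R.rN⟩

def collR {n : ℕ} (c' r' : ZMod (n + 1)) (R : Rect (n + 1)) : Rect n :=
  ⟨coll c' R.cW, coll c' R.cE, coll r' R.rS, coll r' R.rN⟩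

lemma collR_sectR {n : ℕ} [NeZero n] (c' r' : ZMod (n + 1)) (R : Rect n) :
    collR c' r' (sectR c' r' R) = R := by
  obtain ⟨a, b, c, d⟩ := R
  simp only [collR, sectR, coll_sect]

lemma mult_sectR {n : ℕ} [NeZero n] (c' r' : ZMod (n + 1)) (R : Rect n) (i j : ZMod (n + 1)) :
    (sectR c' r' R).mult (i, j) = R.mult (coll c' i, coll r' j) := by
  unfold Rect.mult
  refine if_congr ?_ rfl rfl
  exact and_congr (inIco_coll _ _ _ _) (inIco_coll _ _ _ _)

lemma isRect_lift {n : ℕ} [NeZero n] (c' r' : ZMod (n + 1)) (x y : GridState n) (R : Rect n) :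
    IsRectFrom (stLift c' r' x) (stLift c' r' y) (sectR c' r' R) ↔ IsRectFrom x y R := by
  have hc := (sect_inj c')
  have hr := (sect_inj r')
  unfold IsRectFrom sectR
  simp only [stLift_sect, hc.eq_iff, hr.eq_iff, hc.ne_iff, hr.ne_iff, Ne]
  refine and_congr_right fun _ => and_congr_right fun _ => and_congr_right fun _ =>
    and_congr_right fun _ => and_congr_right fun _ => and_congr_right fun _ => ?_
  constructor
  · intro h k k1 k2
    have := h (sect c' k) (fun e => k1 (hc e)) (fun e => k2 (hc e))
    rw [stLift_sect, stLift_sect] at this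
    exact hr this
  · intro h k k1 k2
    by_cases hk : k = c' + 1
    · rw [hk, stLift_c, stLift_c]
    · rw [← sect_coll c' k hk, stLift_sect, stLift_sect, h]
      · intro e; exact k1 (by rw [← e, sect_coll c' k hk])
      · intro e; exact k2 (by rw [← e, sect_coll c' k hk])

lemma rect_of_lift {n : ℕ} [NeZero n] (c' r' : ZMod (n + 1)) (x y : GridState n)
    (R : Rect (n + 1)) (h : IsRectFrom (stLift c' r' x) (stLift c' r' y) R) :
    sectR c' r' (collR c' r' R) = R := by
  obtain ⟨h1, h2, x1, x2, y1, y2, -⟩ := h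
  have e1 : R.cW ≠ c' + 1 := by
    intro e; rw [e, stLift_c] at x1 y1; exact h2 (x1.symm.trans y1)
  have e2 : R.cE ≠ c' + 1 := by
    intro e; rw [e, stLift_c] at x2 y2; exact h2 (y2.symm.trans x2)
  have e3 : R.rS ≠ r' + 1 := by
    intro e; rw [e, ← stLift_c c' r' x] at x1; exact e1 ((stLift c' r' x).injective x1)
  have e4 : R.rN ≠ r' + 1 := by
    intro e; rw [e, ← stLift_c c' r' x] at x2; exact e2 ((stLift c' r' x).injective x2)
  obtain ⟨a, b, c, d⟩ := R
  simp only at e1 e2 e3 e4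
  simp only [collR, sectR, sect_coll _ _ e1, sect_coll _ _ e2, sect_coll _ _ e3, sect_coll _ _ e4]

/-- the stabilization data of type `X:SW`, unfolded -/
lemma stab_unfold {n : ℕ} [NeZero n] {G : GridDiagram n} {G' : GridDiagram (n + 1)}
    {c' r' : ZMod (n + 1)} (hst : IsStabAt G G' c' r' false false true) :
    G'.Orow (c' + 1) = r' + 1 ∧ G'.Xrow c' = r' + 1 ∧ G'.Xrow (c' + 1) = r' ∧
    G.Xrow (c'.val : ZMod n) = (r'.val : ZMod n) ∧
    (∀ k, k ≠ c' + 1 → coll r' (G'.Orow k) = G.Orow (coll c' k)) ∧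
    (∀ k, coll r' (G'.Xrow k) = G.Xrow (coll c' k)) := by
  unfold IsStabAt at hst
  simp only [if_true, Bool.false_eq_true, if_false] at hst
  obtain ⟨⟨h1, h2, h3, h4, h5⟩, h6⟩ := hst
  refine ⟨h1, h2, h3, h4, ?_, ?_⟩
  · intro k hk
    by_cases hk2 : k = c'
    · rw [hk2, coll_self, h5]
    · exact (h6 k hk2 hk).1.symm
  · intro k
    by_cases hk2 : k = c'
    · rw [hk2, h2, coll_self, coll_succ, h4]
    by_cases hk : k = c' + 1
    · rw [hk, h3, coll_self, coll_succ, h4]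
    · exact (h6 k hk2 hk).2.symm

lemma xdisj_lift {n : ℕ} [NeZero n] {G : GridDiagram n} {G' : GridDiagram (n + 1)}
    {c' r' : ZMod (n + 1)} (hst : IsStabAt G G' c' r' false false true) (R : Rect n) :
    XDisjoint G' (sectR c' r' R) ↔ XDisjoint G R := by
  obtain ⟨-, -, -, -, -, hX⟩ := stab_unfold hst
  unfold XDisjoint Xcount
  simp only [mult_sectR, hX]
  constructor
  · intro h i
    have := h (sect c' i)
    rwa [coll_sect] at this
  · intro h i
    exact h _

lemma wt_lift {n : ℕ} [NeZero n] {G : GridDiagram n} {G' : GridDiagram (n + 1)}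
    {c' r' : ZMod (n + 1)} (hst : IsStabAt G G' c' r' false false true) (x : GridState n)
    (R : Rect n) (hR : XDisjoint G R) :
    wtB G' (stLift c' r' x) (sectR c' r' R) = renUp c' (wtB G x R) := by
  obtain ⟨h1, -, -, h4, hO, -⟩ := stab_unfold hst
  have h0 : R.mult ((c'.val : ZMod n), (r'.val : ZMod n)) = 0 := by
    have := hR (c'.val : ZMod n)
    unfold Xcount at this
    rwa [h4] at this
  have hO1 : Ocount G' (sectR c' r' R) (c' + 1) = 0 := by
    unfold Ocount
    rw [mult_sectR, h1, coll_succ, coll_succ, h0]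
  have hOs : ∀ j, Ocount G' (sectR c' r' R) (sect c' j) = Ocount G R j := by
    intro j
    unfold Ocount
    rw [mult_sectR, hO _ (sect_ne c' j), coll_sect]
  have hI : Rect.intCount (stLift c' r' x) (sectR c' r' R) = Rect.intCount x R := by
    unfold Rect.intCount
    rw [Finset.card_filter, Finset.card_filter, sum_sect c', if_neg, zero_add]
    · refine Finset.sum_congr rfl fun j _ => ?_
      refine if_congr ?_ rfl rfl
      rw [stLift_sect]
      exact and_congr (inIoo_sect _ _ _ _) (inIoo_sect _ _ _ _)
    · rw [stLift_c]
      rintro ⟨q1, q2⟩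
      have := mult_sectR c' r' R (c' + 1) (r' + 1)
      rw [coll_succ, coll_succ, h0] at this
      unfold Rect.mult at this
      rw [if_pos ⟨((inIoo_iff _ _ _).mp q1).2, ((inIoo_iff _ _ _).mp q2).2⟩] at this
      omega
  unfold wtB
  rw [hI, prod_sect c', hO1, pow_zero, one_mul]
  simp only [hOs]
  simp [renUp, Vv, vV, map_prod]

lemma sum_lift {n : ℕ} [NeZero n] {M : Type*} [AddCommMonoid M] {G : GridDiagram n}
    {G' : GridDiagram (n + 1)}
    {c' r' : ZMod (n + 1)} (hst : IsStabAt G G' c' r' false false true) (x y : GridState n)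
    (g : Rng (n + 1) → M) :
    (∑ r ∈ Finset.univ.filter (fun r : Rect (n + 1) =>
        IsRectFrom (stLift c' r' x) (stLift c' r' y) r ∧ XDisjoint G' r),
      g (wtB G' (stLift c' r' x) r)) =
    ∑ r ∈ Finset.univ.filter (fun r : Rect n => IsRectFrom x y r ∧ XDisjoint G r),
      g (renUp c' (wtB G x r)) := by
  symm
  refine Finset.sum_nbij' (sectR c' r') (collR c' r') ?_ ?_ ?_ ?_ ?_
  · intro R hR
    simp only [Finset.mem_filter, Finset.mem_univ, true_and] at hR ⊢
    exact ⟨(isRect_lift _ _ _ _ _).mpr hR.1, (xdisj_lift hst _).mpr hR.2⟩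
  · intro R hR
    simp only [Finset.mem_filter, Finset.mem_univ, true_and] at hR ⊢
    have e := rect_of_lift _ _ _ _ _ hR.1
    rw [← e] at hR
    exact ⟨(isRect_lift _ _ _ _ _).mp hR.1, (xdisj_lift hst _).mp hR.2⟩
  · intro R _
    exact collR_sectR _ _ _
  · intro R hR
    simp only [Finset.mem_filter, Finset.mem_univ, true_and] at hR
    exact rect_of_lift _ _ _ _ _ hR.1
  · intro R hR
    simp only [Finset.mem_filter, Finset.mem_univ, true_and] at hR
    rw [wt_lift hst x R hR.2]

/-! ### Bijectivity and the chain map property -/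

lemma basisMap_single {n : ℕ} (f : GridState n → GC n) (x : GridState n) (a : Rng n) :
    basisMap f (Finsupp.single x a) = a • f x := by
  simp [basisMap]

lemma basisMapP_single {n : ℕ} (f : GridState n → GCP n) (x : GridState n) (a : Rng (n + 1)) :
    basisMapP f (Finsupp.single x a) = a • f x := by
  simp [basisMapP]

lemma e4map_single {n : ℕ} (c' r' : ZMod (n + 1)) (x : GridState (n + 1)) (a : Rng (n + 1)) :
    e4map c' r' (Finsupp.single x a) =
      if x (c' + 1) = r' + 1 then Finsupp.single (stColl c' r' x) a else 0 := by
  simp only [e4map, Finsupp.lsum_single, LinearMap.toSpanSingleton_apply]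
  split_ifs <;> simp

lemma stLift_inj {n : ℕ} [NeZero n] (c' r' : ZMod (n + 1)) :
    Function.Injective (stLift c' r' : GridState n → _) :=
  Function.LeftInverse.injective (stColl_stLift c' r')

lemma sum_states {n : ℕ} [NeZero n] {M : Type*} [AddCommMonoid M] (c' r' : ZMod (n + 1))
    (f : GridState (n + 1) → M) :
    (∑ y, if y (c' + 1) = r' + 1 then f y else 0) = ∑ y : GridState n, f (stLift c' r' y) := by
  rw [← Finset.sum_filter]
  refine Finset.sum_nbij' (stColl c' r') (stLift c' r') ?_ ?_ ?_ ?_ ?_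
  · intro y _; exact Finset.mem_univ _
  · intro y _
    simp only [Finset.mem_filter, Finset.mem_univ, true_and]
    exact stLift_c _ _ _
  · intro y hy
    simp only [Finset.mem_filter, Finset.mem_univ, true_and] at hy
    exact stLift_stColl _ _ _ hy
  · intro y _; exact stColl_stLift _ _ _
  · intro y hy
    simp only [Finset.mem_filter, Finset.mem_univ, true_and] at hy
    rw [stLift_stColl _ _ _ hy]

lemma chain_single {n : ℕ} [NeZero n] {G : GridDiagram n} {G' : GridDiagram (n + 1)}
    {c' r' : ZMod (n + 1)} (hst : IsStabAt G G' c' r' false false true) (x : GridState n)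
    (a : Rng (n + 1)) :
    e4map c' r' (diff4 G' (Finsupp.single (stLift c' r' x) a)) =
      diffP G c' (e4map c' r' (Finsupp.single (stLift c' r' x) a)) := by
  rw [e4map_single, if_pos (stLift_c _ _ _), stColl_stLift]
  unfold diff4 diffP
  rw [basisMap_single, basisMapP_single, map_smul]
  congr 1
  rw [map_sum]
  simp only [map_sum]
  have h1 : ∀ y : GridState (n + 1), (∑ r ∈ Finset.univ.filter
        (fun r : Rect (2 * (n + 1)) => IsRect4From (stLift c' r' x) y r ∧ normal4 r ∧
          XDisjoint4 G' r),
      e4map c' r' (Finsupp.single y (wt4 G' (stLift c' r' x) y r))) =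
      if y (c' + 1) = r' + 1 then
        (∑ r ∈ Finset.univ.filter (fun r : Rect (n + 1) =>
            IsRectFrom (stLift c' r' x) y r ∧ XDisjoint G' r),
          Finsupp.single (stColl c' r' y) (wtB G' (stLift c' r' x) r)) else 0 := by
    intro y
    rw [sum_rect4 G' (stLift c' r' x) y (fun w => e4map c' r' (Finsupp.single y w))]
    simp only [e4map_single]
    split_ifs with h
    · rfl
    · simp
  rw [Finset.sum_congr rfl fun y _ => h1 y, sum_states]
  refine Finset.sum_congr rfl fun y _ => ?_
  rw [stColl_stLift, sum_lift hst x y (fun w => Finsupp.single y w),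
    sum_rect4 G x y (fun w => Finsupp.single y (renUp c' w))]

def liftMap {n : ℕ} [NeZero n] (c' r' : ZMod (n + 1)) : GCP n →ₗ[Rng (n + 1)] GC (n + 1) :=
  Finsupp.lmapDomain (Rng (n + 1)) (Rng (n + 1)) (stLift c' r')

lemma liftMap_single {n : ℕ} [NeZero n] (c' r' : ZMod (n + 1)) (x : GridState n)
    (a : Rng (n + 1)) :
    liftMap c' r' (Finsupp.single x a) = Finsupp.single (stLift c' r' x) a := by
  simp [liftMap, Finsupp.lmapDomain_apply, Finsupp.mapDomain_single]

lemma e4_lift {n : ℕ} [NeZero n] (c' r' : ZMod (n + 1)) (z : GCP n) :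
    e4map c' r' (liftMap c' r' z) = z := by
  induction z using Finsupp.induction_linear with
  | zero => simp
  | add f g hf hg => rw [map_add, map_add, hf, hg]
  | single x a => rw [liftMap_single, e4map_single, if_pos (stLift_c _ _ _), stColl_stLift]

lemma lift_mem {n : ℕ} [NeZero n] (c' r' : ZMod (n + 1)) (z : GCP n) :
    liftMap c' r' z ∈ Isub c' r' := by
  induction z using Finsupp.induction_linear with
  | zero => simp
  | add f g hf hg => rw [map_add]; exact Submodule.add_mem _ hf hg
  | single x a =>
    rw [liftMap_single]
    exact Finsupp.single_mem_supported _ _ (stLift_c c' r' x)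

lemma lift_e4 {n : ℕ} [NeZero n] (c' r' : ZMod (n + 1)) (z : GC (n + 1)) (hz : z ∈ Isub c' r') :
    liftMap c' r' (e4map c' r' z) = z := by
  conv_rhs => rw [← Finsupp.sum_single z]
  conv_lhs => rw [← Finsupp.sum_single z]
  unfold Finsupp.sum
  rw [map_sum, map_sum]
  refine Finset.sum_congr rfl fun x hx => ?_
  have hxc : x (c' + 1) = r' + 1 := (Finsupp.mem_supported _ _).mp hz hx
  rw [e4map_single, if_pos hxc, liftMap_single, stLift_stColl _ _ _ hxc]

lemma e4_bij {n : ℕ} [NeZero n] (c' r' : ZMod (n + 1)) :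
    Function.Bijective (⇑(e4map c' r' ∘ₗ (Isub (n := n) c' r').subtype)) := by
  constructor
  · rintro ⟨z, hz⟩ ⟨w, hw⟩ h
    have h' : e4map c' r' z = e4map c' r' w := h
    apply Subtype.ext
    change z = w
    rw [← lift_e4 c' r' z hz, ← lift_e4 c' r' w hw, h']
  · intro z
    exact ⟨⟨liftMap c' r' z, lift_mem c' r' z⟩, e4_lift c' r' z⟩

lemma chain_all {n : ℕ} [NeZero n] {G : GridDiagram n} {G' : GridDiagram (n + 1)}
    {c' r' : ZMod (n + 1)} (hst : IsStabAt G G' c' r' false false true)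
    (z : GC (n + 1)) (hz : z ∈ Isub c' r') :
    e4map c' r' (diff4 G' z) = diffP G c' (e4map c' r' z) := by
  rw [← lift_e4 c' r' z hz]
  generalize e4map c' r' z = w
  induction w using Finsupp.induction_linear with
  | zero => simp
  | add f g hf hg => simp only [map_add]; rw [hf, hg]
  | single x a => rw [liftMap_single]; exact chain_single hst x a

lemma e4_apply {n : ℕ} [NeZero n] (c' r' : ZMod (n + 1)) (z : GC (n + 1))
    (hz : z ∈ Isub c' r') (y : GridState n) : e4map c' r' z y = z (stLift c' r' y) := by
  conv_rhs => rw [← lift_e4 c' r' z hz]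
  unfold liftMap
  rw [Finsupp.lmapDomain_apply, Finsupp.mapDomain_apply (stLift_inj c' r')]


def ker {m : ℕ} (a k l : ZMod m) : ℤ := Int.sign (((k - a).val : ℤ) - ((l - a).val : ℤ))

lemma ker_anti {m : ℕ} (a k l : ZMod m) : ker a l k = - ker a k l := by
  unfold ker; rw [← Int.sign_neg, neg_sub]

/-- Kronecker delta -/
def dl {α : Type*} (a b : α) : ℤ := if a = b then 1 else 0

lemma dl_equiv {α β : Type*} (e : α ≃ β) (a b : α) : dl (e a) (e b) = dl a b := by
  unfold dl; simp only [e.injective.eq_iff]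

/-- the quadratic form computing Maslov gradings -/
def TT {α : Type*} [Fintype α] (A B : α → α → ℤ) (x f : Equiv.Perm α) : ℤ :=
  ∑ k, ∑ l, A k l * B (x k) (x l)
    - 2 * ∑ k, ∑ l, (A k l - dl k l) * (B (x k) (f l) - dl (x k) (f l))
    + ∑ k, ∑ l, A k l * B (f k) (f l)

lemma TT_transp {α : Type*} [Fintype α] (A B : α → α → ℤ) (x f : Equiv.Perm α) :
    TT A B x f = TT B A x⁻¹ f⁻¹ := by
  unfold TT
  have h1 : ∀ y : Equiv.Perm α, ∑ k, ∑ l, A k l * B (y k) (y l)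
      = ∑ k, ∑ l, B k l * A (y⁻¹ k) (y⁻¹ l) := by
    intro y
    conv_rhs => rw [← Equiv.sum_comp y]
    refine Finset.sum_congr rfl fun k _ => ?_
    conv_rhs => rw [← Equiv.sum_comp y]
    refine Finset.sum_congr rfl fun l _ => ?_
    simp only [Equiv.Perm.inv_def, Equiv.symm_apply_apply]; rw [mul_comm]
  have h2 : ∑ k, ∑ l, (A k l - dl k l) * (B (x k) (f l) - dl (x k) (f l))
      = ∑ k, ∑ l, (B k l - dl k l) * (A (x⁻¹ k) (f⁻¹ l) - dl (x⁻¹ k) (f⁻¹ l)) := by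
    conv_rhs => rw [← Equiv.sum_comp x]
    refine Finset.sum_congr rfl fun k _ => ?_
    conv_rhs => rw [← Equiv.sum_comp f]
    refine Finset.sum_congr rfl fun l _ => ?_
    simp only [Equiv.Perm.inv_def, Equiv.symm_apply_apply]; rw [mul_comm]
  rw [h1 x, h1 f, h2]

lemma sum_dl_left {α : Type*} [Fintype α] (g : α → ℤ) (x f : Equiv.Perm α) :
    ∑ k, ∑ l, g k * dl (x k) (f l) = ∑ k, g k := by
  refine Finset.sum_congr rfl fun k _ => ?_
  rw [← Finset.mul_sum, ← Equiv.sum_comp f⁻¹]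
  simp [dl]

lemma sum_dl_right {α : Type*} [Fintype α] (g : α → ℤ) (x f : Equiv.Perm α) :
    ∑ k, ∑ l, g l * dl (x k) (f l) = ∑ k, g k := by
  rw [Finset.sum_comm]
  refine Finset.sum_congr rfl fun k _ => ?_
  rw [← Finset.mul_sum, ← Equiv.sum_comp x⁻¹]
  simp [dl]

lemma sum_B_left {α : Type*} [Fintype α] (B : α → α → ℤ) (g : α → ℤ) (x f : Equiv.Perm α) :
    ∑ k, ∑ l, g k * B (x k) (f l) = ∑ k, g k * ∑ j, B (x k) j := by
  refine Finset.sum_congr rfl fun k _ => ?_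
  rw [← Finset.mul_sum, Equiv.sum_comp f (fun j => B (x k) j)]

lemma sum_B_right {α : Type*} [Fintype α] (B : α → α → ℤ) (hB : ∀ i j, B j i = - B i j)
    (g : α → ℤ) (x f : Equiv.Perm α) :
    ∑ k, ∑ l, g l * B (x k) (f l) = - ∑ k, g k * ∑ j, B (f k) j := by
  rw [Finset.sum_comm, ← sum_B_left B g f x, ← Finset.sum_neg_distrib]
  refine Finset.sum_congr rfl fun k _ => ?_
  rw [← Finset.sum_neg_distrib]
  refine Finset.sum_congr rfl fun l _ => ?_
  rw [hB]; ring

lemma TT_shift {α : Type*} [Fintype α] (A A' B : α → α → ℤ) (L : α → ℤ)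
    (hA : ∀ k l, A' k l = A k l + 2 * (L k - L l)) (hB : ∀ i j, B j i = - B i j)
    (x f : Equiv.Perm α) : TT A' B x f = TT A B x f := by
  have h1 : ∀ y : Equiv.Perm α, ∑ k, ∑ l, A' k l * B (y k) (y l)
      = ∑ k, ∑ l, A k l * B (y k) (y l) + 4 * ∑ k, L k * ∑ j, B (y k) j := by
    intro y
    have : ∀ k l, A' k l * B (y k) (y l) = A k l * B (y k) (y l)
      + (2 * (L k * B (y k) (y l)) - 2 * (L l * B (y k) (y l))) := by
      intro k l; rw [hA]; ring
    simp only [this, Finset.sum_add_distrib, Finset.sum_sub_distrib, ← Finset.mul_sum]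
    have e1 := sum_B_left B L y y
    have e2 := sum_B_right B hB L y y
    simp only [← Finset.mul_sum] at e1 e2 ⊢
    linarith
  have h2 : ∑ k, ∑ l, (A' k l - dl k l) * (B (x k) (f l) - dl (x k) (f l))
      = ∑ k, ∑ l, (A k l - dl k l) * (B (x k) (f l) - dl (x k) (f l))
        + 2 * ∑ k, L k * ∑ j, B (x k) j + 2 * ∑ k, L k * ∑ j, B (f k) j := by
    have : ∀ k l, (A' k l - dl k l) * (B (x k) (f l) - dl (x k) (f l))
      = (A k l - dl k l) * (B (x k) (f l) - dl (x k) (f l))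
      + ((2 * (L k * B (x k) (f l)) - 2 * (L l * B (x k) (f l)))
        - (2 * (L k * dl (x k) (f l)) - 2 * (L l * dl (x k) (f l)))) := by
      intro k l; rw [hA]; ring
    simp only [this]
    rw [Finset.sum_congr rfl fun k _ => Finset.sum_add_distrib, Finset.sum_add_distrib]
    simp only [Finset.sum_sub_distrib, ← Finset.mul_sum]
    have e1 := sum_B_left B L x f
    have e2 := sum_B_right B hB L x f
    have e3 := sum_dl_left L x f
    have e4 := sum_dl_right L x f
    simp only [← Finset.mul_sum] at e1 e2 e3 e4 ⊢
    linarith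
  unfold TT
  rw [h1 x, h1 f, h2]; ring

lemma ker_shift {m : ℕ} [NeZero m] (a k l : ZMod m) :
    ker a k l = ker 0 k l + 2 * ((if k.val < a.val then 1 else 0) - (if l.val < a.val then 1 else 0)) := by
  have h1 := sub_val_rel 0 k a
  have h2 := sub_val_rel 0 l a
  simp only [sub_zero] at h1 h2
  unfold ker
  rw [h1, h2, sub_zero, sub_zero]
  have b1 := ZMod.val_lt k
  have b2 := ZMod.val_lt l
  have b3 := ZMod.val_lt a
  generalize k.val = K at *
  generalize l.val = K' at *
  generalize a.val = A at *
  split_ifs <;> first | omega | skip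
  · rw [show ((K - A : ℕ) : ℤ) - ((K' - A : ℕ) : ℤ) = (K : ℤ) - K' by omega]; ring
  · rw [Int.sign_eq_neg_one_of_neg (by omega), Int.sign_eq_one_of_pos (by omega)]; rfl
  · rw [Int.sign_eq_one_of_pos (by omega), Int.sign_eq_neg_one_of_neg (by omega)]; rfl
  · rw [show ((K + m - A : ℕ) : ℤ) - ((K' + m - A : ℕ) : ℤ) = (K : ℤ) - K' by omega]; ring

lemma TT_cut {m : ℕ} [NeZero m] (a b : ZMod m) (x f : Equiv.Perm (ZMod m)) :
    TT (ker a) (ker b) x f = TT (ker 0) (ker 0) x f := by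
  rw [TT_shift (ker 0) (ker a) (ker b) _ (ker_shift a) (ker_anti b),
    TT_transp, TT_shift (ker 0) (ker b) (ker 0) _ (ker_shift b) (ker_anti 0), ← TT_transp]

/-! Maslov grading as a double sum -/

lemma Icnt_eq {m : ℕ} [NeZero m] (x y : ZMod m → ZMod m) (a b : ℕ) :
    Icnt (ptsOf x a) (ptsOf y b) = ∑ k : ZMod m, ∑ l : ZMod m,
      if 2 * k.val + a < 2 * l.val + b ∧ 2 * (x k).val + a < 2 * (y l).val + b then 1 else 0 := by
  have inj : ∀ (z : ZMod m → ZMod m) (c : ℕ), Function.Injective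
      (fun k : ZMod m => (2 * k.val + c, 2 * (z k).val + c)) := by
    intro z c k l h
    have := congrArg Prod.fst h
    simp only at this
    exact ZMod.val_injective m (by omega)
  unfold Icnt
  simp only [Finset.card_filter]
  unfold ptsOf
  rw [Finset.sum_image (fun k _ l _ h => inj x a h)]
  refine Finset.sum_congr rfl fun k _ => ?_
  rw [Finset.sum_image (fun k _ l _ h => inj y b h)]

lemma sign_cases (a : ℤ) : (0 < a ∧ a.sign = 1) ∨ (a = 0 ∧ a.sign = 0) ∨ (a < 0 ∧ a.sign = -1) := by
  rcases lt_trichotomy a 0 with h | h | h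
  · exact Or.inr (Or.inr ⟨h, Int.sign_eq_neg_one_of_neg h⟩)
  · exact Or.inr (Or.inl ⟨h, by rw [h]; rfl⟩)
  · exact Or.inl ⟨h, Int.sign_eq_one_of_pos h⟩

lemma Jxx {m : ℕ} [NeZero m] (f : Equiv.Perm (ZMod m)) (a : ℕ) :
    Jq (ptsOf f a) (ptsOf f a)
      = ((m : ℚ) * m - m + ((∑ k, ∑ l, ker 0 k l * ker 0 (f k) (f l) : ℤ) : ℚ)) / 4 := by
  have key : ∀ k l : ZMod m,
      2 * (((if 2 * k.val + a < 2 * l.val + a ∧ 2 * (f k).val + a < 2 * (f l).val + a then 1 else 0 : ℕ) : ℤ)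
        + ((if 2 * l.val + a < 2 * k.val + a ∧ 2 * (f l).val + a < 2 * (f k).val + a then 1 else 0 : ℕ) : ℤ))
      = 1 - dl k l + ker 0 k l * ker 0 (f k) (f l) := by
    intro k l
    unfold ker dl
    simp only [sub_zero]
    by_cases h : k = l
    · subst h; simp
    · have h1 : k.val ≠ l.val := fun e => h (ZMod.val_injective m e)
      have h2 : (f k).val ≠ (f l).val := fun e => h (f.injective (ZMod.val_injective m e))
      rw [if_neg h]
      rcases sign_cases ((k.val : ℤ) - l.val) with ⟨p, q⟩ | ⟨p, q⟩ | ⟨p, q⟩ <;>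
      rcases sign_cases (((f k).val : ℤ) - (f l).val) with ⟨p', q'⟩ | ⟨p', q'⟩ | ⟨p', q'⟩ <;>
      rw [q, q'] <;> split_ifs <;> first | omega | rfl
  have hs : (2 * (((Icnt (ptsOf f a) (ptsOf f a) : ℕ) : ℤ) + (Icnt (ptsOf f a) (ptsOf f a) : ℕ)) : ℤ)
      = (m : ℤ) * m - m + ∑ k, ∑ l, ker 0 k l * ker 0 (f k) (f l) := by
    have e : ∑ k : ZMod m, ∑ l : ZMod m, (dl k l : ℤ) = m := by
      have := sum_dl_left (fun _ : ZMod m => 1) 1 1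
      simpa [ZMod.card] using this
    have e' : ∑ k : ZMod m, ∑ l : ZMod m, (1 : ℤ) = m * m := by simp [ZMod.card]
    rw [← e', ← e]
    simp only [← Finset.sum_sub_distrib, ← Finset.sum_add_distrib, ← key]
    simp only [← Finset.mul_sum, Finset.sum_add_distrib]
    rw [Icnt_eq]
    congr 2
    · push_cast; rfl
    · rw [Finset.sum_comm]; push_cast; rfl
  have hq : (2 * (((Icnt (ptsOf f a) (ptsOf f a) : ℕ) : ℚ) + (Icnt (ptsOf f a) (ptsOf f a) : ℕ)) : ℚ)
      = (m : ℚ) * m - m + ((∑ k, ∑ l, ker 0 k l * ker 0 (f k) (f l) : ℤ) : ℚ) := by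
    exact_mod_cast hs
  unfold Jq
  rw [← hq]; ring

lemma Jxf {m : ℕ} [NeZero m] (x f : Equiv.Perm (ZMod m)) :
    Jq (ptsOf x 0) (ptsOf f 1)
      = ((m : ℚ) * m + ((∑ k, ∑ l, (ker 0 k l - dl k l) *
          (ker 0 (x k) (f l) - dl (x k) (f l)) : ℤ) : ℚ)) / 4 := by
  have kd : ∀ k l : ZMod m, (k.val < l.val + 1 ∧ ker 0 k l - dl k l = -1) ∨
      (l.val < k.val ∧ ker 0 k l - dl k l = 1) := by
    intro k l
    unfold ker dl
    simp only [sub_zero]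
    by_cases h : k = l
    · subst h; left; simp
    · have h1 : k.val ≠ l.val := fun e => h (ZMod.val_injective m e)
      rw [if_neg h]
      rcases sign_cases ((k.val : ℤ) - l.val) with ⟨p, q⟩ | ⟨p, q⟩ | ⟨p, q⟩ <;> rw [q] <;> omega
  have key : ∀ k l : ZMod m,
      2 * (((if 2 * k.val + 0 < 2 * l.val + 1 ∧ 2 * (x k).val + 0 < 2 * (f l).val + 1 then 1 else 0 : ℕ) : ℤ)
        + ((if 2 * l.val + 1 < 2 * k.val + 0 ∧ 2 * (f l).val + 1 < 2 * (x k).val + 0 then 1 else 0 : ℕ) : ℤ))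
      = 1 + (ker 0 k l - dl k l) * (ker 0 (x k) (f l) - dl (x k) (f l)) := by
    intro k l
    rcases kd k l with ⟨p, q⟩ | ⟨p, q⟩ <;> rcases kd (x k) (f l) with ⟨p', q'⟩ | ⟨p', q'⟩ <;>
      rw [q, q'] <;> split_ifs <;> first | omega | rfl
  have hs : (2 * (((Icnt (ptsOf x 0) (ptsOf f 1) : ℕ) : ℤ) + (Icnt (ptsOf f 1) (ptsOf x 0) : ℕ)) : ℤ)
      = (m : ℤ) * m + ∑ k, ∑ l, (ker 0 k l - dl k l) *
          (ker 0 (x k) (f l) - dl (x k) (f l)) := by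
    have e' : ∑ k : ZMod m, ∑ l : ZMod m, (1 : ℤ) = m * m := by simp [ZMod.card]
    rw [← e']
    simp only [← Finset.sum_add_distrib, ← key]
    simp only [← Finset.mul_sum, Finset.sum_add_distrib]
    rw [Icnt_eq, Icnt_eq]
    congr 2
    · push_cast; rfl
    · rw [Finset.sum_comm]; push_cast; rfl
  have hq : (2 * (((Icnt (ptsOf x 0) (ptsOf f 1) : ℕ) : ℚ) + (Icnt (ptsOf f 1) (ptsOf x 0) : ℕ)) : ℚ)
      = (m : ℚ) * m + ((∑ k, ∑ l, (ker 0 k l - dl k l) *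
          (ker 0 (x k) (f l) - dl (x k) (f l)) : ℤ) : ℚ) := by
    exact_mod_cast hs
  unfold Jq
  rw [← hq]; ring

lemma maslov_eq {m : ℕ} [NeZero m] (a b : ZMod m) (x f : Equiv.Perm (ZMod m)) :
    MaslovOf f x = ((TT (ker a) (ker b) x f : ℤ) - 2 * (m : ℚ)) / 4 + 1 := by
  rw [TT_cut]
  unfold MaslovOf TT
  rw [Jxx, Jxx, Jxf]; push_cast; ring

/-! Stabilization -/

lemma ker_sect {n : ℕ} [NeZero n] (a : ZMod (n + 1)) (i j : ZMod n) :
    ker a (sect a i) (sect a j) = ker (a.val : ZMod n) i j := by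
  unfold ker
  rw [sect_val, sect_val]
  generalize (i - (a.val : ZMod n)).val = I
  generalize (j - (a.val : ZMod n)).val = J
  rcases sign_cases ((I : ℤ) - J) with ⟨p, q⟩ | ⟨p, q⟩ | ⟨p, q⟩ <;> rw [q] <;> unfold phi
  · apply Int.sign_eq_one_of_pos; split_ifs <;> omega
  · rw [Int.sign_eq_zero_iff_zero]; split_ifs <;> omega
  · apply Int.sign_eq_neg_one_of_neg; split_ifs <;> omega

lemma ker_self {m : ℕ} (a k : ZMod m) : ker a k k = 0 := by unfold ker; simp

lemma TT_stab {n : ℕ} [NeZero n] (c' r' : ZMod (n + 1)) (x f : Equiv.Perm (ZMod n))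
    (x' f' : Equiv.Perm (ZMod (n + 1))) (hx : x' (c' + 1) = r' + 1) (hf : f' (c' + 1) = r' + 1)
    (hxs : ∀ j, x' (sect c' j) = sect r' (x j)) (hfs : ∀ j, f' (sect c' j) = sect r' (f j)) :
    TT (ker c') (ker r') x' f' =
      TT (ker (c'.val : ZMod n)) (ker (r'.val : ZMod n)) x f - 2 := by
  have d1 : ∀ a (j : ZMod n), dl (a + 1) (sect a j) = 0 := by
    intro a j; unfold dl; rw [if_neg (sect_ne a j).symm]
  have d2 : ∀ a (j : ZMod n), dl (sect a j) (a + 1) = 0 := by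
    intro a j; unfold dl; rw [if_neg (sect_ne a j)]
  have d3 : ∀ (a : ZMod (n + 1)) (i j : ZMod n), dl (sect a i) (sect a j) = dl i j := by
    intro a i j; unfold dl
    by_cases h : i = j
    · rw [h, if_pos rfl, if_pos rfl]
    · rw [if_neg h, if_neg (fun e => h (sect_inj a e))]
  have d4 : ∀ a : ZMod (n + 1), dl a a = 1 := by intro a; unfold dl; rw [if_pos rfl]
  have k2 : ∀ (a : ZMod (n + 1)) (j : ZMod n), ker a (sect a j) (a + 1) = - ker a (a + 1) (sect a j) :=
    fun a j => ker_anti _ _ _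
  unfold TT
  simp only [sum_sect c', hx, hf, hxs, hfs, d1, d2, d3, d4, k2, ker_sect, ker_self,
    Finset.sum_add_distrib, sub_zero, neg_mul_neg]
  ring

/-- reindexing by a transposition of the two new columns -/
lemma TT_swap {n : ℕ} [NeZero n] (c' r' : ZMod (n + 1)) (x f g : Equiv.Perm (ZMod (n + 1)))
    (hg : ∀ k, g k = f (Equiv.swap c' (c' + 1) k))
    (hx : x (c' + 1) = r' + 1) (hf : f (c' + 1) = r' + 1) (hf0 : f c' = r') :
    TT (ker c') (ker r') x g = TT (ker c') (ker r') x f + 4 := by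
  have h01 : ∀ a : ZMod (n + 1), a ≠ a + 1 := by
    intro a h
    have := (eq_succ_iff a a).mp h
    rw [sub_self, ZMod.val_zero] at this
    omega
  have v0 : ∀ a : ZMod (n + 1), (a - a).val = 0 := by intro a; rw [sub_self, ZMod.val_zero]
  have v1 : ∀ a : ZMod (n + 1), (a + 1 - a).val = 1 := by
    intro a; rw [add_sub_cancel_left, one_val]
  have vk : ∀ a k : ZMod (n + 1), k ≠ a → k ≠ a + 1 → 2 ≤ (k - a).val := by
    intro a k h0 h1
    rw [Ne, eq_succ_iff] at h1
    have : (k - a).val ≠ 0 := by rw [Ne, ZMod.val_eq_zero, sub_eq_zero]; exact h0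
    omega
  have w1 : ∀ a : ZMod (n + 1), ker a (a + 1) a = 1 := by
    intro a; unfold ker; rw [v0, v1]; rfl
  have w2 : ∀ a : ZMod (n + 1), ker a a (a + 1) = -1 := by
    intro a; unfold ker; rw [v0, v1]; rfl
  have w3 : ∀ a k : ZMod (n + 1), k ≠ a → k ≠ a + 1 → ker a k a = 1 := by
    intro a k h0 h1; have := vk a k h0 h1
    unfold ker; rw [v0]; apply Int.sign_eq_one_of_pos; omega
  have w4 : ∀ a k : ZMod (n + 1), k ≠ a → k ≠ a + 1 → ker a k (a + 1) = 1 := by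
    intro a k h0 h1; have := vk a k h0 h1
    unfold ker; rw [v1]; apply Int.sign_eq_one_of_pos; omega
  have w5 : ∀ a k : ZMod (n + 1), k ≠ a → k ≠ a + 1 → ker a a k = -1 := by
    intro a k h0 h1; rw [ker_anti, w3 a k h0 h1]
  have w6 : ∀ a k : ZMod (n + 1), k ≠ a → k ≠ a + 1 → ker a (a + 1) k = -1 := by
    intro a k h0 h1; rw [ker_anti, w4 a k h0 h1]
  have d4 : ∀ a : ZMod (n + 1), dl a a = 1 := by intro a; unfold dl; rw [if_pos rfl]
  have d5 : ∀ a b : ZMod (n + 1), a ≠ b → dl a b = 0 := by intro a b h; unfold dl; rw [if_neg h]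
  have sL : Equiv.swap c' (c' + 1) c' = c' + 1 := Equiv.swap_apply_left _ _
  have sR : Equiv.swap c' (c' + 1) (c' + 1) = c' := Equiv.swap_apply_right _ _
  have sN : ∀ k, k ≠ c' → k ≠ c' + 1 → Equiv.swap c' (c' + 1) k = k :=
    fun k => Equiv.swap_apply_of_ne_of_ne
  have n1 := h01 c'
  have n2 := (h01 c').symm
  have K1 : ∀ k l, ker c' (Equiv.swap c' (c' + 1) k) (Equiv.swap c' (c' + 1) l)
      = ker c' k l + 2 * (dl k c' * dl l (c' + 1)) - 2 * (dl k (c' + 1) * dl l c') := by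
    intro k l
    by_cases a0 : k = c' <;> by_cases a1 : k = c' + 1 <;> by_cases b0 : l = c' <;>
      by_cases b1 : l = c' + 1 <;>
      simp only [a0, a1, b0, b1, sL, sR, sN, d4, d5, n1, n2, w1, w2, w3, w4, w5, w6, ker_self,
        not_false_eq_true, ne_eq] <;> simp_all
  have K2 : ∀ k l, ker c' k (Equiv.swap c' (c' + 1) l) - dl k (Equiv.swap c' (c' + 1) l)
      = (ker c' k l - dl k l) + 2 * (dl k (c' + 1) * dl l (c' + 1))
        - 2 * (dl k (c' + 1) * dl l c') := by
    intro k l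
    by_cases a0 : k = c' <;> by_cases a1 : k = c' + 1 <;> by_cases b0 : l = c' <;>
      by_cases b1 : l = c' + 1 <;>
      simp only [a0, a1, b0, b1, sL, sR, sN, d4, d5, n1, n2, w1, w2, w3, w4, w5, w6, ker_self,
        not_false_eq_true, ne_eq] <;> simp_all
  have pick : ∀ (p q : ZMod (n + 1)) (F : ZMod (n + 1) → ZMod (n + 1) → ℤ),
      ∑ k, ∑ l, dl k p * dl l q * F k l = F p q := by
    intro p q F
    simp only [dl, ite_mul, one_mul, zero_mul, Finset.sum_ite_eq', Finset.mem_univ, if_true,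
      Finset.sum_ite_irrel, Finset.sum_const_zero]
  have H1 : ∑ k, ∑ l, ker c' k l * ker r' (g k) (g l)
      = ∑ k, ∑ l, ker c' k l * ker r' (f k) (f l) - 4 := by
    rw [← Equiv.sum_comp (Equiv.swap c' (c' + 1))]
    have : ∀ k, ∑ l, ker c' (Equiv.swap c' (c' + 1) k) l *
        ker r' (g (Equiv.swap c' (c' + 1) k)) (g l)
        = ∑ l, (ker c' k l * ker r' (f k) (f l)
          + 2 * (dl k c' * dl l (c' + 1) * ker r' (f k) (f l))
          - 2 * (dl k (c' + 1) * dl l c' * ker r' (f k) (f l))) := by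
      intro k
      rw [← Equiv.sum_comp (Equiv.swap c' (c' + 1))]
      refine Finset.sum_congr rfl fun l _ => ?_
      rw [hg, hg, Equiv.swap_apply_self, Equiv.swap_apply_self, K1]; ring
    simp only [this, Finset.sum_add_distrib, Finset.sum_sub_distrib]
    simp only [← Finset.mul_sum, pick]
    have p1 := pick c' (c' + 1) (fun k l => ker r' (f k) (f l))
    have p2 := pick (c' + 1) c' (fun k l => ker r' (f k) (f l))
    simp only [hf, hf0, w1, w2] at p1 p2 ⊢
    linarith
  have H2 : ∑ k, ∑ l, (ker c' k l - dl k l) * (ker r' (x k) (g l) - dl (x k) (g l))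
      = ∑ k, ∑ l, (ker c' k l - dl k l) * (ker r' (x k) (f l) - dl (x k) (f l)) - 4 := by
    have : ∀ k, ∑ l, (ker c' k l - dl k l) * (ker r' (x k) (g l) - dl (x k) (g l))
        = ∑ l, ((ker c' k l - dl k l) * (ker r' (x k) (f l) - dl (x k) (f l))
          + 2 * (dl k (c' + 1) * dl l (c' + 1) * (ker r' (x k) (f l) - dl (x k) (f l)))
          - 2 * (dl k (c' + 1) * dl l c' * (ker r' (x k) (f l) - dl (x k) (f l)))) := by
      intro k
      rw [← Equiv.sum_comp (Equiv.swap c' (c' + 1))]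
      refine Finset.sum_congr rfl fun l _ => ?_
      rw [hg, Equiv.swap_apply_self, K2]; ring
    rw [Finset.sum_congr rfl fun k _ => this k]
    have p1 := pick (c' + 1) (c' + 1) (fun k l => ker r' (x k) (f l) - dl (x k) (f l))
    have p2 := pick (c' + 1) c' (fun k l => ker r' (x k) (f l) - dl (x k) (f l))
    rw [hx, hf, ker_self, d4] at p1
    rw [hx, hf0, w1, d5 _ _ (h01 r').symm] at p2
    rw [Finset.sum_congr rfl fun k _ => Finset.sum_sub_distrib _ _, Finset.sum_sub_distrib,
      Finset.sum_congr rfl fun k _ => Finset.sum_add_distrib, Finset.sum_add_distrib,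
      Finset.sum_congr rfl fun k _ => (Finset.mul_sum _ _ _).symm, ← Finset.mul_sum, p1,
      Finset.sum_congr rfl fun k _ => (Finset.mul_sum _ _ _).symm, ← Finset.mul_sum, p2]
    ring
  unfold TT
  rw [H1, H2]; ring

lemma sect_of_coll {n : ℕ} [NeZero n] {c' r' : ZMod (n + 1)} (f : Equiv.Perm (ZMod n))
    (f' : Equiv.Perm (ZMod (n + 1))) (hf : f' (c' + 1) = r' + 1)
    (h : ∀ k, k ≠ c' + 1 → coll r' (f' k) = f (coll c' k)) (j : ZMod n) :
    f' (sect c' j) = sect r' (f j) := by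
  have h1 : f' (sect c' j) ≠ r' + 1 := by
    rw [← hf]; exact fun e => sect_ne c' j (f'.injective e)
  rw [← sect_coll r' _ h1, h _ (sect_ne c' j), coll_sect]

lemma maslovO_lift {n : ℕ} [NeZero n] {G : GridDiagram n} {G' : GridDiagram (n + 1)}
    {c' r' : ZMod (n + 1)} (hst : IsStabAt G G' c' r' false false true) (x : GridState n) :
    MaslovO G' (stLift c' r' x) = MaslovO G x - 1 := by
  obtain ⟨h1, -, -, -, h5, -⟩ := stab_unfold hst
  have e := maslov_eq (c'.val : ZMod n) (r'.val : ZMod n) x (Equiv.ofBijective _ G.hO)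
  have e' := maslov_eq c' r' (stLift c' r' x) (Equiv.ofBijective _ G'.hO)
  rw [TT_stab c' r' x (Equiv.ofBijective _ G.hO) (stLift c' r' x) (Equiv.ofBijective _ G'.hO)
    (stLift_c _ _ _) h1 (stLift_sect c' r' x) (sect_of_coll _ _ h1 h5)] at e'
  unfold MaslovO
  refine e'.trans ?_
  refine Eq.trans ?_ (congrArg (· - 1) e.symm)
  push_cast; ring

lemma maslovX_lift {n : ℕ} [NeZero n] {G : GridDiagram n} {G' : GridDiagram (n + 1)}
    {c' r' : ZMod (n + 1)} (hst : IsStabAt G G' c' r' false false true) (x : GridState n) :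
    MaslovX G' (stLift c' r' x) = MaslovX G x := by
  obtain ⟨-, h2, h3, -, -, h6⟩ := stab_unfold hst
  have e := maslov_eq (c'.val : ZMod n) (r'.val : ZMod n) x (Equiv.ofBijective _ G.hX)
  have e' := maslov_eq c' r' (stLift c' r' x) (Equiv.ofBijective _ G'.hX)
  have f1 : ((Equiv.swap c' (c' + 1)).trans (Equiv.ofBijective _ G'.hX)) (c' + 1) = r' + 1 := by
    rw [Equiv.trans_apply, Equiv.swap_apply_right]; exact h2
  have f0 : ((Equiv.swap c' (c' + 1)).trans (Equiv.ofBijective _ G'.hX)) c' = r' := by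
    rw [Equiv.trans_apply, Equiv.swap_apply_left]; exact h3
  have fc : ∀ k, k ≠ c' + 1 →
      coll r' (((Equiv.swap c' (c' + 1)).trans (Equiv.ofBijective _ G'.hX)) k)
        = (Equiv.ofBijective _ G.hX) (coll c' k) := by
    intro k hk
    rw [Equiv.trans_apply]
    refine (h6 _).trans ?_
    by_cases h : k = c'
    · rw [h, Equiv.swap_apply_left, coll_succ, coll_self]; rfl
    · rw [Equiv.swap_apply_of_ne_of_ne h hk]; rfl
  rw [TT_swap c' r' (stLift c' r' x) ((Equiv.swap c' (c' + 1)).trans (Equiv.ofBijective _ G'.hX))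
      (Equiv.ofBijective _ G'.hX)
      (fun k => by rw [Equiv.trans_apply, Equiv.swap_apply_self]) (stLift_c _ _ _) f1 f0,
    TT_stab c' r' x (Equiv.ofBijective _ G.hX) (stLift c' r' x) _
    (stLift_c _ _ _) f1 (stLift_sect c' r' x) (sect_of_coll _ _ f1 fc)] at e'
  unfold MaslovX
  refine e'.trans ?_
  refine Eq.trans ?_ e.symm
  push_cast; ring

lemma homog_part {n : ℕ} [NeZero n] {G : GridDiagram n} {G' : GridDiagram (n + 1)}
    {c' r' : ZMod (n + 1)} (hst : IsStabAt G G' c' r' false false true)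
    (z : GC (n + 1)) (hz : z ∈ Isub c' r') (d s : ℚ) (h : IsHomog G' z d s) :
    IsHomogP G (e4map c' r' z) (d + 1) (s + 1) := by
  intro y k hk
  rw [e4_apply c' r' z hz] at hk
  obtain ⟨h1, h2⟩ := h _ _ hk
  unfold Alex at h2 ⊢
  rw [maslovX_lift hst] at h2
  rw [maslovO_lift hst] at h1 h2
  push_cast at h2
  constructor <;> linarith

/-- For a stabilization of type `X:SW`, the correspondence
`x' = x ∪ {c} ↦ x` between `I₄(𝔾₄')` and `S₄(𝔾₄)` induces an isomorphism
`e₄ : (I₄, ∂_{I₄}^{I₄}) → GC•(𝔾₄)[V₁]⟦1,1⟧` of bigraded chain complexes over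
`𝔽[V₁,…,V_n,v]`. -/
theorem statement14 (n : ℕ) [NeZero n] (G : GridDiagram n) (G' : GridDiagram (n + 1))
    (c' r' : ZMod (n + 1)) (hst : IsStabAt G G' c' r' false false true) :
    Function.Bijective (⇑(e4map c' r' ∘ₗ (Isub c' r').subtype)) ∧
    (∀ z ∈ Isub c' r', e4map c' r' (diff4 G' z) = diffP G c' (e4map c' r' z)) ∧
    (∀ z ∈ Isub c' r', ∀ d s : ℚ,
      IsHomog G' z d s → IsHomogP G (e4map c' r' z) (d + 1) (s + 1)) := by
  exact ⟨e4_bij c' r', fun z hz => chain_all hst z hz, fun z hz d s h => homog_part hst z hz d s h⟩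

end GridHomology
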